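/- Let (ΛV,d) = (Λ(x₁,x₂,y₁,y₂,z), d) be the minimal Sullivan model of the homogeneous space SU(6)/(SU(3)×SU(3)), with |x₁| = 4, |x₂| = 6, dx₁ = dx₂ = 0, dy₁ = x₁², dy₂ = x₂², dz = x₁x₂. Then for every integer r ≥ 2, TC_r(ΛV) = 3r − 1. -/

import Mathlib

noncomputable section

namespace RHT

/-- A graded-commutative differential graded algebra over `ℚ`, graded by `ℕ`,
with a degree `+1` differential satisfying the graded Leibniz rule. -/
class GCDGA (A : Type) extends Ring A, Algebra ℚ A where
  grading : ℕ → Submodule ℚ A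
  gradedAlgebra : GradedAlgebra grading
  grading_comm : ∀ (i j : ℕ) (a b : A), a ∈ grading i → b ∈ grading j →
    a * b = ((-1 : ℚ) ^ (i * j)) • (b * a)
  d : A →ₗ[ℚ] A
  d_sq : ∀ a : A, d (d a) = 0
  d_grading : ∀ (i : ℕ) (a : A), a ∈ grading i → d a ∈ grading (i + 1)
  d_leibniz : ∀ (i : ℕ) (a b : A), a ∈ grading i →
    d (a * b) = d a * b + ((-1 : ℚ) ^ i) • (a * d b)

/-- The grading of a gcdga, with the algebra explicit. -/
def Gr (A : Type) [GCDGA A] : ℕ → Submodule ℚ A := GCDGA.grading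

/-- The differential of a gcdga, with the algebra explicit. -/
def Dd (A : Type) [GCDGA A] : A →ₗ[ℚ] A := GCDGA.d

/-- Morphisms of cdga's: `ℚ`-algebra morphisms preserving the grading and
commuting with the differentials. -/
def IsDGAHom {A B : Type} [GCDGA A] [GCDGA B] (f : A →ₐ[ℚ] B) : Prop :=
  (∀ a : A, f (Dd A a) = Dd B (f a)) ∧
    ∀ (i : ℕ) (a : A), a ∈ Gr A i → f a ∈ Gr B i

theorem isDGAHom_id (A : Type) [GCDGA A] : IsDGAHom (AlgHom.id ℚ A) :=
  ⟨fun _ => rfl, fun _ _ h => h⟩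

/-- A quasi-isomorphism: a morphism inducing an isomorphism in cohomology
(stated elementwise: surjectivity and injectivity on cohomology classes). -/
def QuasiIso {A B : Type} [GCDGA A] [GCDGA B] (f : A →ₐ[ℚ] B) : Prop :=
  (∀ b : B, Dd B b = 0 → ∃ a : A, Dd A a = 0 ∧ ∃ c : B, f a - b = Dd B c) ∧
    ∀ a : A, Dd A a = 0 → (∃ c : B, f a = Dd B c) → ∃ e : A, a = Dd A e

/-- Injectivity in cohomology, stated elementwise. -/
def CohomologyInjective {A B : Type} [GCDGA A] [GCDGA B] (f : A →ₐ[ℚ] B) : Prop :=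
  ∀ a : A, Dd A a = 0 → (∃ c : B, f a = Dd B c) → ∃ e : A, a = Dd A e

/-- A homotopy retraction for a morphism `ρ` of cdga's: a factorization of `ρ`
through a surjective quasi-isomorphism `q : C → Q` (playing the role of the
relative Sullivan model of `ρ`) together with a cdga retraction `τ`. -/
structure HtpyRetraction {T Q : Type} [GCDGA T] [GCDGA Q] (ρ : T →ₐ[ℚ] Q) where
  C : Type
  [instC : GCDGA C]
  j : T →ₐ[ℚ] C
  q : C →ₐ[ℚ] Q
  τ : C →ₐ[ℚ] T
  j_dga : IsDGAHom j
  q_dga : IsDGAHom q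
  τ_dga : IsDGAHom τ
  q_surj : Function.Surjective q
  q_quasi : QuasiIso q
  hqj : q.comp j = ρ
  hτj : τ.comp j = AlgHom.id ℚ T

attribute [instance] HtpyRetraction.instC

/-- A homotopy retraction of `T`-modules for a morphism `ρ : T → Q` of cdga's:
as above, but the retraction `τ` is only required to be a morphism of
differential `T`-modules. -/
structure ModHtpyRetraction {T Q : Type} [GCDGA T] [GCDGA Q] (ρ : T →ₐ[ℚ] Q) where
  C : Type
  [instC : GCDGA C]
  j : T →ₐ[ℚ] C
  q : C →ₐ[ℚ] Q
  τ : C →ₗ[ℚ] T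
  j_dga : IsDGAHom j
  q_dga : IsDGAHom q
  q_surj : Function.Surjective q
  q_quasi : QuasiIso q
  hqj : q.comp j = ρ
  τ_chain : ∀ c : C, τ (Dd C c) = Dd T (τ c)
  τ_mod : ∀ (t : T) (c : C), τ (j t * c) = t * τ c
  hτj : ∀ t : T, τ (j t) = t

attribute [instance] ModHtpyRetraction.instC

/-- `T`, together with the morphisms `ι j : A → T`, is the `r`-fold (graded)
tensor power of `A`, characterized as the `r`-fold coproduct of copies of `A`
in the category of cdga's. -/
structure TensorPower (A : Type) [GCDGA A] (r : ℕ) (T : Type) [GCDGA T] where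
  ι : Fin r → (A →ₐ[ℚ] T)
  ι_dga : ∀ j, IsDGAHom (ι j)
  coprod : ∀ (B : Type) [GCDGA B] (f : Fin r → (A →ₐ[ℚ] B)), (∀ j, IsDGAHom (f j)) →
    ∃! g : T →ₐ[ℚ] B, IsDGAHom g ∧ ∀ j, g.comp (ι j) = f j

/-- The `r`-fold multiplication morphism `μ : A^{⊗ r} → A`, i.e. the fold map
of the coproduct. -/
noncomputable def TensorPower.mu {A : Type} [GCDGA A] {r : ℕ} {T : Type} [GCDGA T]
    (TP : TensorPower A r T) : T →ₐ[ℚ] A :=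
  (TP.coprod A (fun _ => AlgHom.id ℚ A) (fun _ => isDGAHom_id A)).choose

/-- The kernel of the `r`-fold multiplication, as a `ℚ`-submodule (ideal). -/
noncomputable def TensorPower.kerMu {A : Type} [GCDGA A] {r : ℕ} {T : Type} [GCDGA T]
    (TP : TensorPower A r T) : Submodule ℚ T :=
  LinearMap.ker TP.mu.toLinearMap

/-- A witness that `TC_r(ΛV) ≤ n`: the projection
`ρ^r_n : (ΛV)^{⊗ r} → (ΛV)^{⊗ r}/(ker μ^r)^{n+1}` admits a homotopy retraction
of cdga's.  The quotient is encoded as a surjective cdga morphism with kernel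
`(ker μ^r)^{n+1}`. -/
structure TCWitness (A : Type) [GCDGA A] (r n : ℕ) where
  T : Type
  [instT : GCDGA T]
  TP : TensorPower A r T
  Q : Type
  [instQ : GCDGA Q]
  ρ : T →ₐ[ℚ] Q
  ρ_dga : IsDGAHom ρ
  ρ_surj : Function.Surjective ρ
  ρ_ker : LinearMap.ker ρ.toLinearMap = TP.kerMu ^ (n + 1)
  retr : Nonempty (HtpyRetraction ρ)

/-- The higher rational topological complexity `TC_r`. -/
noncomputable def TC (A : Type) [GCDGA A] (r : ℕ) : ℕ :=
  sInf {n | Nonempty (TCWitness A r n)}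

/-- A witness that `MTC_r(ΛV) ≤ n`: `ρ^r_n` admits a homotopy retraction of
`(ΛV)^{⊗ r}`-modules. -/
structure MTCWitness (A : Type) [GCDGA A] (r n : ℕ) where
  T : Type
  [instT : GCDGA T]
  TP : TensorPower A r T
  Q : Type
  [instQ : GCDGA Q]
  ρ : T →ₐ[ℚ] Q
  ρ_dga : IsDGAHom ρ
  ρ_surj : Function.Surjective ρ
  ρ_ker : LinearMap.ker ρ.toLinearMap = TP.kerMu ^ (n + 1)
  retr : Nonempty (ModHtpyRetraction ρ)

/-- The higher module rational topological complexity `MTC_r`. -/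
noncomputable def MTC (A : Type) [GCDGA A] (r : ℕ) : ℕ :=
  sInf {n | Nonempty (MTCWitness A r n)}

/-- A witness that `HTC_r(ΛV) ≤ n`: `ρ^r_n` is injective in cohomology. -/
structure HTCWitness (A : Type) [GCDGA A] (r n : ℕ) where
  T : Type
  [instT : GCDGA T]
  TP : TensorPower A r T
  Q : Type
  [instQ : GCDGA Q]
  ρ : T →ₐ[ℚ] Q
  ρ_dga : IsDGAHom ρ
  ρ_surj : Function.Surjective ρ
  ρ_ker : LinearMap.ker ρ.toLinearMap = TP.kerMu ^ (n + 1)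
  inj : CohomologyInjective ρ

/-- The invariant `HTC_r`. -/
noncomputable def HTC (A : Type) [GCDGA A] (r : ℕ) : ℕ :=
  sInf {n | Nonempty (HTCWitness A r n)}

/-- A minimal Sullivan model structure on a gcdga `A`: a simply-connected
graded space of generators `V` of finite type, the word-length grading `lam`
(`lam k` is `Λ^k V`), freeness of `A` over `V` as a graded-commutative
algebra (expressed by the universal property), and minimality `d V ⊆ Λ^{≥2}V`. -/
structure MinimalSullivan (A : Type) [GCDGA A] where
  V : ℕ → Submodule ℚ A
  lam : ℕ → Submodule ℚ A
  V_le : ∀ n, V n ≤ Gr A n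
  V0 : V 0 = ⊥
  V1 : V 1 = ⊥
  V_fin : ∀ n, FiniteDimensional ℚ (V n)
  lam_zero : lam 0 = 1
  lam_one : lam 1 = ⨆ n, V n
  lam_mul : ∀ p q, lam p * lam q ≤ lam (p + q)
  lam_internal : DirectSum.IsInternal lam
  minimal : ∀ (n : ℕ), ∀ v ∈ V n, Dd A v ∈ ⨆ k, ⨆ (_ : 2 ≤ k), lam k
  free : ∀ (B : Type) [GCDGA B] (f : ∀ n, V n →ₗ[ℚ] B),
    (∀ (n : ℕ) (v : V n), f n v ∈ Gr B n) →
    ∃! g : A →ₐ[ℚ] B, (∀ (i : ℕ) (a : A), a ∈ Gr A i → g a ∈ Gr B i) ∧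
      ∀ (n : ℕ) (v : V n), g (v : A) = f n v

namespace MinimalSullivan

variable {A : Type} [GCDGA A] (S : MinimalSullivan A)

/-- The even part of the space of generators. -/
def Veven : Submodule ℚ A := ⨆ n, S.V (2 * n)

/-- The odd part of the space of generators. -/
def Vodd : Submodule ℚ A := ⨆ n, S.V (2 * n + 1)

/-- The homotopy characteristic `χ_π = dim V^even - dim V^odd`. -/
noncomputable def chiPi : ℤ :=
  (Module.finrank ℚ S.Veven : ℤ) - (Module.finrank ℚ S.Vodd : ℤ)

/-- Purity: `d V^even = 0` and `d V^odd ⊆ Λ V^even`. -/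
def Pure : Prop :=
  (∀ a ∈ S.Veven, Dd A a = 0) ∧
    ∀ a ∈ S.Vodd, Dd A a ∈ Algebra.adjoin ℚ (S.Veven : Set A)

/-- Coformality: the differential is quadratic, `d V ⊆ Λ² V`. -/
def Coformal : Prop := ∀ (n : ℕ), ∀ v ∈ S.V n, Dd A v ∈ S.lam 2

/-- Constant length `l` of the differential: `d V ⊆ Λ^l V`. -/
def ConstantLength (l : ℕ) : Prop := ∀ (n : ℕ), ∀ v ∈ S.V n, Dd A v ∈ S.lam l

end MinimalSullivan

/-- The cohomology of a gcdga, as a `ℚ`-module. -/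
def CohClasses (A : Type) [GCDGA A] :=
  LinearMap.ker (Dd A) ⧸ ((LinearMap.range (Dd A)).comap (LinearMap.ker (Dd A)).subtype)

instance (A : Type) [GCDGA A] : AddCommGroup (CohClasses A) := by
  unfold CohClasses; infer_instance

instance (A : Type) [GCDGA A] : Module ℚ (CohClasses A) := by
  unfold CohClasses; infer_instance

/-- Ellipticity: both the generating space `V` and the cohomology are
finite-dimensional. -/
def Elliptic (A : Type) [GCDGA A] (S : MinimalSullivan A) : Prop :=
  FiniteDimensional ℚ (⨆ n, S.V n : Submodule ℚ A) ∧ FiniteDimensional ℚ (CohClasses A)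

/-- A witness of formality: a quasi-isomorphism to a gcdga with zero
differential. -/
structure FormalityWitness (A : Type) [GCDGA A] where
  B : Type
  [instB : GCDGA B]
  hd : Dd B = 0
  ψ : A →ₐ[ℚ] B
  ψ_dga : IsDGAHom ψ
  ψ_quasi : QuasiIso ψ

/-- Formality of a (Sullivan) cdga. -/
def Formal (A : Type) [GCDGA A] : Prop := Nonempty (FormalityWitness A)

/-- A witness that `cat(ΛV) ≤ n`: the projection `ΛV → ΛV/Λ^{>n}V` admits a
homotopy retraction.  The quotient is encoded as a surjective cdga morphism
whose kernel is `Λ^{>n}V`. -/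
structure CatWitness (A : Type) [GCDGA A] (S : MinimalSullivan A) (n : ℕ) where
  Q : Type
  [instQ : GCDGA Q]
  π : A →ₐ[ℚ] Q
  π_dga : IsDGAHom π
  π_surj : Function.Surjective π
  π_ker : LinearMap.ker π.toLinearMap = ⨆ k, ⨆ (_ : n < k), S.lam k
  retr : Nonempty (HtpyRetraction π)

/-- The rational LS-category. -/
noncomputable def cat (A : Type) [GCDGA A] (S : MinimalSullivan A) : ℕ :=
  sInf {n | Nonempty (CatWitness A S n)}

/-- A witness that `zcl_r(ΛV) ≥ p`: `p` cocycles in `(ΛV)^{⊗ r}` whose classes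
are zero-divisors (killed by `H(μ^r)`) and whose product is not exact. -/
structure ZclWitness (A : Type) [GCDGA A] (r p : ℕ) where
  T : Type
  [instT : GCDGA T]
  TP : TensorPower A r T
  a : Fin p → T
  closed : ∀ i, Dd T (a i) = 0
  zero_div : ∀ i, ∃ b : A, TP.mu (a i) = Dd A b
  prod_ne : ∀ b : T, (List.ofFn a).prod ≠ Dd T b

/-- The `r`-zero-divisor-cuplength `zcl_r`. -/
noncomputable def zcl (A : Type) [GCDGA A] (r : ℕ) : ℕ :=
  sSup {p | Nonempty (ZclWitness A r p)}

/-- A witness that `cl_ℚ(ΛV) ≥ p`: `p` cocycles of positive degree with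
non-exact product. -/
structure ClWitness (A : Type) [GCDGA A] (p : ℕ) where
  a : Fin p → A
  pos : ∀ i, a i ∈ ⨆ k, ⨆ (_ : 0 < k), Gr A k
  closed : ∀ i, Dd A (a i) = 0
  prod_ne : ∀ b : A, (List.ofFn a).prod ≠ Dd A b

/-- The rational cuplength `cl_ℚ`. -/
noncomputable def clQ (A : Type) [GCDGA A] : ℕ :=
  sSup {p | Nonempty (ClWitness A p)}

section Basics

variable {A : Type} [GCDGA A]

instance : GradedAlgebra (Gr A) := GCDGA.gradedAlgebra

theorem hom_induction {p : A → Prop} (hom : ∀ i, ∀ a ∈ Gr A i, p a)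
    (add : ∀ a b, p a → p b → p (a + b)) (a : A) : p a :=
  DirectSum.Decomposition.inductionOn (Gr A) (hom 0 0 (zero_mem _))
    (fun m => hom _ _ m.2) add a

theorem one_mem_Gr : (1 : A) ∈ Gr A 0 := SetLike.GradedOne.one_mem

theorem mul_mem_Gr {i j : ℕ} {a b : A} (ha : a ∈ Gr A i) (hb : b ∈ Gr A j) :
    a * b ∈ Gr A (i + j) := SetLike.GradedMul.mul_mem ha hb

theorem iSup_Gr : ⨆ i, Gr A i = ⊤ :=
  (DirectSum.Decomposition.isInternal (Gr A)).submodule_iSup_eq_top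

theorem Dd_Dd (a : A) : Dd A (Dd A a) = 0 := GCDGA.d_sq a

theorem Dd_mem {i : ℕ} {a : A} (ha : a ∈ Gr A i) : Dd A a ∈ Gr A (i + 1) :=
  GCDGA.d_grading i a ha

theorem Gr_comm {i j : ℕ} {a b : A} (ha : a ∈ Gr A i) (hb : b ∈ Gr A j) :
    a * b = ((-1 : ℚ) ^ (i * j)) • (b * a) := GCDGA.grading_comm i j a b ha hb

/-- The operator scaling the degree `i` part by `c i`. -/
def scal (A : Type) [GCDGA A] (c : ℕ → ℚ) : A →ₗ[ℚ] A :=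
  (DirectSum.toModule ℚ ℕ A fun i => c i • (Gr A i).subtype) ∘ₗ
    (DirectSum.decomposeLinearEquiv (Gr A)).toLinearMap

theorem scal_apply (c : ℕ → ℚ) {i : ℕ} {a : A} (ha : a ∈ Gr A i) :
    scal A c a = c i • a := by
  lift a to Gr A i using ha
  rw [scal, LinearMap.comp_apply, LinearEquiv.coe_coe, DirectSum.decomposeLinearEquiv_apply,
    DirectSum.decompose_coe, ← DirectSum.lof_eq_of ℚ, DirectSum.toModule_lof]
  rfl

theorem scal_mem (c : ℕ → ℚ) {i : ℕ} {a : A} (ha : a ∈ Gr A i) : scal A c a ∈ Gr A i := by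
  rw [scal_apply c ha]; exact Submodule.smul_mem _ _ ha

theorem map_scal {B : Type} [GCDGA B] (g : A →ₐ[ℚ] B)
    (hg : ∀ (i : ℕ) (a : A), a ∈ Gr A i → g a ∈ Gr B i) (c : ℕ → ℚ) (a : A) :
    g (scal A c a) = scal B c (g a) := by
  induction a using hom_induction with
  | hom i a ha => rw [scal_apply c ha, scal_apply c (hg i a ha), map_smul]
  | add a b ha hb => simp only [map_add, ha, hb]

/-- Every element is a finite sum of its homogeneous components. -/
theorem exists_sum_components (a : A) : ∃ n : ℕ, ∀ m, n ≤ m →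
    ∑ k ∈ Finset.range m, scal A (Pi.single k 1) a = a := by
  induction a using hom_induction with
  | hom i a ha =>
    refine ⟨i + 1, fun m hm => ?_⟩
    simp only [scal_apply _ ha]
    rw [Finset.sum_eq_single i]
    · simp
    · intro b _ hb; simp [hb.symm]
    · intro h; simp at h; omega
  | add a b ha hb =>
    obtain ⟨n, hn⟩ := ha
    obtain ⟨n', hn'⟩ := hb
    refine ⟨n + n', fun m hm => ?_⟩
    simp only [map_add, Finset.sum_add_distrib, hn m (by omega), hn' m (by omega)]

theorem scal_single_mem (k : ℕ) (a : A) : scal A (Pi.single k 1) a ∈ Gr A k := by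
  induction a using hom_induction with
  | hom i a ha =>
    rw [scal_apply _ ha]
    by_cases h : i = k
    · subst h; simpa using ha
    · simp [h]
  | add a b ha hb => rw [map_add]; exact add_mem ha hb

/-- The automorphism acting on the degree `i` part by `(-1) ^ (n * i)`. -/
def tw (A : Type) [GCDGA A] (n : ℕ) : A →ₐ[ℚ] A :=
  AlgHom.ofLinearMap (scal A fun i => (-1) ^ (n * i))
    (by rw [scal_apply _ one_mem_Gr]; simp)
    (by
      intro x y
      induction x using hom_induction with
      | hom i x hx =>
        induction y using hom_induction with
        | hom j y hy =>
          rw [scal_apply _ hx, scal_apply _ hy, scal_apply _ (mul_mem_Gr hx hy), mul_add, pow_add,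
            smul_mul_smul_comm]
        | add a b ha hb => simp only [mul_add, map_add, ha, hb]
      | add a b ha hb => simp only [add_mul, map_add, ha, hb])

theorem tw_apply (n : ℕ) {i : ℕ} {a : A} (ha : a ∈ Gr A i) :
    tw A n a = ((-1 : ℚ) ^ (n * i)) • a := scal_apply _ ha

theorem tw_mem (n : ℕ) {i : ℕ} {a : A} (ha : a ∈ Gr A i) : tw A n a ∈ Gr A i :=
  scal_mem _ ha

theorem map_tw {B : Type} [GCDGA B] (g : A →ₐ[ℚ] B)
    (hg : ∀ (i : ℕ) (a : A), a ∈ Gr A i → g a ∈ Gr B i) (n : ℕ) (a : A) :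
    g (tw A n a) = tw B n (g a) := map_scal g hg _ a

theorem tw_tw (n : ℕ) (a : A) : tw A n (tw A n a) = a := by
  induction a using hom_induction with
  | hom i a ha =>
    rw [tw_apply _ ha, map_smul, tw_apply _ ha, smul_smul, ← mul_pow]; simp
  | add a b ha hb => simp only [map_add, ha, hb]

theorem tw_even {n : ℕ} (hn : Even n) (a : A) : tw A n a = a := by
  induction a using hom_induction with
  | hom i a ha => rw [tw_apply _ ha, (hn.mul_right i).neg_one_pow, one_smul]
  | add a b ha hb => simp only [map_add, ha, hb]

theorem tw_odd {n : ℕ} (hn : Odd n) (a : A) : tw A n a = tw A 1 a := by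
  induction a using hom_induction with
  | hom i a ha => rw [tw_apply _ ha, tw_apply _ ha, pow_mul, hn.neg_one_pow, one_mul]
  | add a b ha hb => simp only [map_add, ha, hb]

theorem tw_add (m n : ℕ) (a : A) : tw A (m + n) a = tw A m (tw A n a) := by
  induction a using hom_induction with
  | hom i a ha =>
    rw [tw_apply _ ha, tw_apply _ ha, map_smul, tw_apply _ ha, smul_smul, ← pow_add]
    congr 2; ring
  | add a b ha hb => simp only [map_add, ha, hb]

theorem tw_Dd (n : ℕ) (a : A) : tw A n (Dd A a) = ((-1 : ℚ) ^ n) • Dd A (tw A n a) := by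
  induction a using hom_induction with
  | hom i a ha =>
    rw [tw_apply _ ha, tw_apply _ (Dd_mem ha), map_smul, smul_smul, ← pow_add]
    congr 2; ring
  | add a b ha hb => simp only [map_add, ha, hb, smul_add]

theorem Dd_mul (a b : A) : Dd A (a * b) = Dd A a * b + tw A 1 a * Dd A b := by
  induction a using hom_induction with
  | hom i a ha =>
    rw [tw_apply _ ha, smul_mul_assoc, one_mul]
    exact GCDGA.d_leibniz i a b ha
  | add a a' ha hb => simp only [map_add, add_mul, ha, hb]; abel

theorem mul_eq_tw_mul {n : ℕ} {u : A} (hu : u ∈ Gr A n) (a : A) : u * a = tw A n a * u := by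
  induction a using hom_induction with
  | hom i a ha => rw [tw_apply _ ha, smul_mul_assoc, Gr_comm hu ha]
  | add a b ha hb => simp only [map_add, mul_add, add_mul, ha, hb]

theorem even_mul_comm {n : ℕ} (hn : Even n) {u : A} (hu : u ∈ Gr A n) (a : A) :
    u * a = a * u := by
  rw [mul_eq_tw_mul hu, tw_even hn]

theorem odd_mul_self {n : ℕ} (hn : Odd n) {u : A} (hu : u ∈ Gr A n) : u * u = 0 := by
  have h := Gr_comm hu hu
  rw [(hn.mul hn).neg_one_pow, neg_smul, one_smul] at h
  have h2 : (2 : ℚ) • (u * u) = 0 := by rw [two_smul]; nth_rewrite 1 [h]; simp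
  simpa using h2

theorem Dd_one : Dd A 1 = 0 := by
  have h := Dd_mul (1 : A) 1
  simp only [map_one, mul_one, one_mul] at h
  simpa using h

theorem Dd_even_mul {n : ℕ} (hn : Even n) {u : A} (hu : u ∈ Gr A n) (hd : Dd A u = 0) (a : A) :
    Dd A (u * a) = u * Dd A a := by
  rw [Dd_mul, hd, zero_mul, zero_add, tw_apply _ hu, one_mul, hn.neg_one_pow, one_smul]

theorem Dd_mul_closed {a b : A} (ha : Dd A a = 0) (hb : Dd A b = 0) : Dd A (a * b) = 0 := by
  rw [Dd_mul, ha, hb]; simp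

/-- The Euler derivation. -/
abbrev euler (A : Type) [GCDGA A] : A →ₗ[ℚ] A := scal A fun i => i

theorem euler_mul (a b : A) : euler A (a * b) = euler A a * b + a * euler A b := by
  induction a using hom_induction with
  | hom i a ha =>
    induction b using hom_induction with
    | hom j b hb =>
      rw [scal_apply _ ha, scal_apply _ hb, scal_apply _ (mul_mem_Gr ha hb), smul_mul_assoc,
        mul_smul_comm, ← add_smul]
      push_cast; rfl
    | add b b' hb hb' => simp only [mul_add, map_add, hb, hb']; abel
  | add a a' ha ha' => simp only [add_mul, map_add, ha, ha']; abel

/-- The degree `k` part of a copy of `A` shifted by `m`. -/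
def Gsh (A : Type) [GCDGA A] (m k : ℕ) : Submodule ℚ A := if m ≤ k then Gr A (k - m) else ⊥

theorem mem_Gsh_add {m l : ℕ} {a : A} (ha : a ∈ Gr A l) : a ∈ Gsh A m (l + m) := by
  rw [Gsh, if_pos (by omega)]; simpa using ha

theorem Gsh_cases {m k : ℕ} {a : A} (ha : a ∈ Gsh A m k) :
    a = 0 ∨ ∃ l, k = l + m ∧ a ∈ Gr A l := by
  rw [Gsh] at ha
  split_ifs at ha with h
  · exact Or.inr ⟨k - m, by omega, ha⟩
  · exact Or.inl (by simpa using ha)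

theorem Gsh_zero (k : ℕ) : Gsh A 0 k = Gr A k := by simp [Gsh]

theorem Gsh_mul {m m' k k' : ℕ} {a b : A} (ha : a ∈ Gsh A m k) (hb : b ∈ Gsh A m' k') :
    a * b ∈ Gsh A (m + m') (k + k') := by
  rcases Gsh_cases ha with rfl | ⟨l, rfl, h⟩
  · simp
  rcases Gsh_cases hb with rfl | ⟨l', rfl, h'⟩
  · simp
  convert mem_Gsh_add (m := m + m') (mul_mem_Gr h h') using 2; ring

theorem Gsh_Dd {m k : ℕ} {a : A} (ha : a ∈ Gsh A m k) : Dd A a ∈ Gsh A m (k + 1) := by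
  rcases Gsh_cases ha with rfl | ⟨l, rfl, h⟩
  · simp
  convert mem_Gsh_add (m := m) (Dd_mem h) using 2; ring

theorem Gsh_euler {m k : ℕ} {a : A} (ha : a ∈ Gsh A m k) :
    euler A a + (m : ℚ) • a = (k : ℚ) • a := by
  rcases Gsh_cases ha with rfl | ⟨l, rfl, h⟩
  · simp
  rw [scal_apply _ h, ← add_smul]; push_cast; rfl

theorem iSupIndep_of_eigen {M N : Type} [AddCommGroup M] [Module ℚ M] [AddCommGroup N]
    [Module ℚ N] (G : ℕ → Submodule ℚ M) (L : M →ₗ[ℚ] N) (hL : Function.Injective L)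
    (E : Module.End ℚ N) (h : ∀ k, ∀ m ∈ G k, E (L m) = (k : ℚ) • L m) : iSupIndep G := by
  have hi : iSupIndep fun k : ℕ => E.eigenspace (k : ℚ) :=
    (Module.End.eigenspaces_iSupIndep E).comp (f := fun k : ℕ => (k : ℚ)) Nat.cast_injective
  have hle : ∀ k, G k ≤ (E.eigenspace (k : ℚ)).comap L := fun k m hm =>
    Module.End.mem_eigenspace_iff.mpr (h k m hm)
  intro i
  rw [Submodule.disjoint_def]
  intro x hx hx'
  have h2 : (⨆ j, ⨆ (_ : j ≠ i), G j) ≤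
      (⨆ j, ⨆ (_ : j ≠ i), E.eigenspace ((j : ℕ) : ℚ)).comap L := by
    refine iSup₂_le fun j hj => (hle j).trans (Submodule.comap_mono ?_)
    exact le_iSup₂_of_le (f := fun (j : ℕ) (_ : j ≠ i) => E.eigenspace (j : ℚ)) j hj le_rfl
  have := (Submodule.disjoint_def.mp (hi i)) (L x) (hle i hx) (h2 hx')
  exact hL (by simpa using this)

/-- A graded algebra structure from an independent, exhaustive, multiplicative family. -/
@[reducible] def mkGraded {M : Type} [Ring M] [Algebra ℚ M] (G : ℕ → Submodule ℚ M)
    (one : (1 : M) ∈ G 0) (mul : ∀ i j, ∀ a ∈ G i, ∀ b ∈ G j, a * b ∈ G (i + j))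
    (ind : iSupIndep G) (top : ⨆ i, G i = ⊤) : GradedAlgebra G :=
  { DirectSum.IsInternal.chooseDecomposition G
      (DirectSum.isInternal_submodule_of_iSupIndep_of_iSup_eq_top ind top) with
    one_mem := one
    mul_mem := fun {i j a b} ha hb => mul i j a ha b hb }

theorem isDGAHom_comp {B C : Type} [GCDGA B] [GCDGA C] {g : B →ₐ[ℚ] C} {f : A →ₐ[ℚ] B}
    (hg : IsDGAHom g) (hf : IsDGAHom f) : IsDGAHom (g.comp f) :=
  ⟨fun a => by simp [hf.1, hg.1], fun i a ha => hg.2 i _ (hf.2 i a ha)⟩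

theorem isDGAHom_of_adjoin {B : Type} [GCDGA B] (g : A →ₐ[ℚ] B)
    (hg : ∀ (i : ℕ) (a : A), a ∈ Gr A i → g a ∈ Gr B i) {s : Set A}
    (hs : Algebra.adjoin ℚ s = ⊤) (h : ∀ a ∈ s, g (Dd A a) = Dd B (g a)) : IsDGAHom g := by
  refine ⟨fun a => ?_, hg⟩
  have ha : a ∈ Algebra.adjoin ℚ s := hs ▸ Algebra.mem_top
  induction ha using Algebra.adjoin_induction with
  | mem x hx => exact h x hx
  | algebraMap q => simp [Algebra.algebraMap_eq_smul_one, Dd_one]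
  | add x y _ _ hx hy => simp [hx, hy]
  | mul x y _ _ hx hy => simp [Dd_mul, hx, hy, map_tw g hg]

end Basics

section Rat

/-- The ground field, concentrated in degree zero. -/
instance ratGCDGA : GCDGA ℚ where
  grading k := if k = 0 then ⊤ else ⊥
  gradedAlgebra := mkGraded _ (by simp)
    (by
      intro i j a ha b hb
      rcases eq_or_ne i 0 with rfl | hi
      · rcases eq_or_ne j 0 with rfl | hj
        · simp
        · simp only [if_neg hj, Submodule.mem_bot] at hb
          simp [hb]
      · simp only [if_neg hi, Submodule.mem_bot] at ha
        simp [ha])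
    (iSupIndep_of_eigen _ LinearMap.id Function.injective_id 0 (by
      intro k m hm
      rcases eq_or_ne k 0 with rfl | hk
      · simp
      · simp only [if_neg hk, Submodule.mem_bot] at hm
        simp [hm]))
    (top_unique (le_iSup_of_le 0 (by simp)))
  grading_comm i j a b ha hb := by
    rcases eq_or_ne i 0 with rfl | hi
    · simp [mul_comm]
    · simp only [if_neg hi, Submodule.mem_bot] at ha
      simp [ha]
  d := 0
  d_sq _ := rfl
  d_grading _ _ _ := by simp
  d_leibniz _ _ _ _ := by simp

theorem Dd_rat : Dd ℚ = 0 := rfl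

theorem isDGAHom_ofId (B : Type) [GCDGA B] : IsDGAHom (Algebra.ofId ℚ B) := by
  refine ⟨fun a => ?_, fun i a ha => ?_⟩
  · rw [Dd_rat, LinearMap.zero_apply, map_zero, Algebra.ofId_apply, Algebra.algebraMap_eq_smul_one,
      map_smul, Dd_one, smul_zero]
  · rcases eq_or_ne i 0 with rfl | hi
    · rw [Algebra.ofId_apply, Algebra.algebraMap_eq_smul_one]
      exact Submodule.smul_mem _ _ one_mem_Gr
    · have : a = 0 := by simpa [Gr, GCDGA.grading, hi] using ha
      simp [this]

end Rat

section SqExt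

/-- The conditions on `f` for adjoining a generator `u` of degree `n` with `u ^ 2 = 0`
and `d u = f`. -/
structure Adm (B : Type) [GCDGA B] (n : ℕ) (f : B) : Prop where
  mem : f ∈ Gr B (n + 1)
  closed : Dd B f = 0
  even : Even n → f = 0

/-- The extension `B ⊕ B u` with `u` of degree `n`, `u ^ 2 = 0` and `d u = f`. -/
def SqExt (B : Type) [GCDGA B] (n : ℕ) (f : B) (_ : Adm B n f) : Type := B × B

namespace SqExt

variable {B : Type} [GCDGA B] {n : ℕ} {f : B} {hf : Adm B n f}

instance : AddCommGroup (SqExt B n f hf) := inferInstanceAs (AddCommGroup (B × B))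

variable (n f hf) in
/-- The element `a + b u`. -/
def mk (a b : B) : SqExt B n f hf := (a, b)

@[simp] theorem fst_mk (a b : B) : (mk n f hf a b).1 = a := rfl
@[simp] theorem snd_mk (a b : B) : (mk n f hf a b).2 = b := rfl

instance : Mul (SqExt B n f hf) :=
  ⟨fun x y => mk n f hf (x.1 * y.1) (x.1 * y.2 + x.2 * tw B n y.1)⟩

instance : One (SqExt B n f hf) := ⟨mk n f hf 1 0⟩

@[ext] theorem ext {x y : SqExt B n f hf} (h₁ : x.1 = y.1) (h₂ : x.2 = y.2) : x = y :=
  Prod.ext h₁ h₂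

@[simp] theorem fst_mul (x y : SqExt B n f hf) : (x * y).1 = x.1 * y.1 := rfl
@[simp] theorem snd_mul (x y : SqExt B n f hf) :
    (x * y).2 = x.1 * y.2 + x.2 * tw B n y.1 := rfl
@[simp] theorem fst_one : (1 : SqExt B n f hf).1 = 1 := rfl
@[simp] theorem snd_one : (1 : SqExt B n f hf).2 = 0 := rfl
@[simp] theorem fst_add (x y : SqExt B n f hf) : (x + y).1 = x.1 + y.1 := rfl
@[simp] theorem snd_add (x y : SqExt B n f hf) : (x + y).2 = x.2 + y.2 := rfl
@[simp] theorem fst_zero : (0 : SqExt B n f hf).1 = 0 := rfl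
@[simp] theorem snd_zero : (0 : SqExt B n f hf).2 = 0 := rfl

instance : Ring (SqExt B n f hf) :=
  { (inferInstance : AddCommGroup (SqExt B n f hf)),
    (inferInstance : Mul (SqExt B n f hf)),
    (inferInstance : One (SqExt B n f hf)) with
    left_distrib := fun a b c => by ext <;> simp [mul_add]; abel
    right_distrib := fun a b c => by ext <;> simp [add_mul]; abel
    zero_mul := fun a => by ext <;> simp
    mul_zero := fun a => by ext <;> simp
    mul_assoc := fun a b c => by ext <;> simp [mul_add, add_mul, mul_assoc, add_assoc]
    one_mul := fun a => by ext <;> simp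
    mul_one := fun a => by ext <;> simp }

/-- The structural map as a ring morphism. -/
def algMap : ℚ →+* SqExt B n f hf where
  toFun q := mk n f hf (algebraMap ℚ B q) 0
  map_one' := by ext <;> simp
  map_zero' := by ext <;> simp
  map_add' _ _ := by ext <;> simp
  map_mul' _ _ := by ext <;> simp

instance : Algebra ℚ (SqExt B n f hf) where
  algebraMap := algMap
  smul q x := mk n f hf (q • x.1) (q • x.2)
  commutes' q x := by
    ext
    · exact Algebra.commutes q x.1
    · change algebraMap ℚ B q * x.2 + 0 * tw B n x.1 = x.1 * 0 + x.2 * tw B n (algebraMap ℚ B q)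
      simp [Algebra.commutes]
  smul_def' q x := by
    ext
    · exact Algebra.smul_def q x.1
    · change q • x.2 = algebraMap ℚ B q * x.2 + 0 * tw B n x.1
      simp [Algebra.smul_def]

@[simp] theorem fst_smul (q : ℚ) (x : SqExt B n f hf) : (q • x).1 = q • x.1 := rfl
@[simp] theorem snd_smul (q : ℚ) (x : SqExt B n f hf) : (q • x).2 = q • x.2 := rfl

variable (B n f hf) in
/-- The underlying pair of coefficients. -/
def toProd : SqExt B n f hf →ₗ[ℚ] B × B where
  toFun x := x
  map_add' _ _ := rfl
  map_smul' _ _ := rfl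

variable (B n f hf) in
/-- The coefficient of the generator. -/
def coef : SqExt B n f hf →ₗ[ℚ] B := LinearMap.snd ℚ B B ∘ₗ toProd B n f hf

@[simp] theorem coef_apply (x : SqExt B n f hf) : coef B n f hf x = x.2 := rfl

variable (B n f hf) in
/-- The inclusion of the base. -/
def incl : B →ₐ[ℚ] SqExt B n f hf where
  toFun b := mk n f hf b 0
  map_one' := rfl
  map_zero' := rfl
  map_add' _ _ := by ext <;> simp
  map_mul' _ _ := by ext <;> simp
  commutes' _ := rfl

@[simp] theorem fst_incl (b : B) : (incl B n f hf b).1 = b := rfl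
@[simp] theorem snd_incl (b : B) : (incl B n f hf b).2 = 0 := rfl

variable (B n f hf) in
/-- The adjoined generator. -/
def gen : SqExt B n f hf := mk n f hf 0 1

@[simp] theorem fst_gen : (gen B n f hf).1 = 0 := rfl
@[simp] theorem snd_gen : (gen B n f hf).2 = 1 := rfl

theorem eq_incl_add (x : SqExt B n f hf) :
    x = incl B n f hf x.1 + incl B n f hf x.2 * gen B n f hf := by
  ext <;> simp

variable (B n f hf) in
/-- The grading of the extension. -/
def grad (k : ℕ) : Submodule ℚ (SqExt B n f hf) :=
  ((Gr B k).prod (Gsh B n k)).comap (toProd B n f hf)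

theorem mem_grad {k : ℕ} {x : SqExt B n f hf} :
    x ∈ grad B n f hf k ↔ x.1 ∈ Gr B k ∧ x.2 ∈ Gsh B n k := Iff.rfl

theorem iSup_grad : ⨆ k, grad B n f hf k = ⊤ := by
  have h1 : ∀ b : B, incl B n f hf b ∈ ⨆ k, grad B n f hf k := by
    intro b
    induction b using hom_induction with
    | hom i a ha => exact Submodule.mem_iSup_of_mem i (mem_grad.mpr ⟨ha, by simp⟩)
    | add a b ha hb => rw [map_add]; exact add_mem ha hb
  have h2 : ∀ b : B, incl B n f hf b * gen B n f hf ∈ ⨆ k, grad B n f hf k := by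
    intro b
    induction b using hom_induction with
    | hom i a ha =>
      exact Submodule.mem_iSup_of_mem (i + n)
        (mem_grad.mpr ⟨by simp, by simpa using mem_Gsh_add ha⟩)
    | add a b ha hb => rw [map_add, add_mul]; exact add_mem ha hb
  refine Submodule.eq_top_iff'.mpr fun x => ?_
  rw [eq_incl_add x]
  exact add_mem (h1 _) (h2 _)

variable (B n f hf) in
/-- The differential of the extension. -/
def diff : SqExt B n f hf →ₗ[ℚ] SqExt B n f hf where
  toFun x := mk n f hf (Dd B x.1 + tw B 1 x.2 * f) (Dd B x.2)
  map_add' x y := by ext <;> simp [add_mul]; abel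
  map_smul' q x := by ext <;> simp

@[simp] theorem fst_diff (x : SqExt B n f hf) :
    (diff B n f hf x).1 = Dd B x.1 + tw B 1 x.2 * f := rfl
@[simp] theorem snd_diff (x : SqExt B n f hf) : (diff B n f hf x).2 = Dd B x.2 := rfl

theorem leibniz {k : ℕ} {x : SqExt B n f hf} (hx : x ∈ grad B n f hf k) (y : SqExt B n f hf) :
    diff B n f hf (x * y) =
      diff B n f hf x * y + ((-1 : ℚ) ^ k) • (x * diff B n f hf y) := by
  obtain ⟨hx1, hx2⟩ := mem_grad.mp hx
  have hfa : ∀ a : B, f * a = tw B 1 (tw B n a) * f := fun a => by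
    rw [mul_eq_tw_mul hf.mem, add_comm, tw_add]
  have ht : ((-1 : ℚ) ^ k) • x.1 = tw B 1 x.1 := by rw [tw_apply _ hx1, one_mul]
  ext
  · simp only [fst_diff, fst_mul, snd_mul, fst_add, fst_smul, ← smul_mul_assoc, ht, Dd_mul,
      map_add, map_mul, add_mul, mul_add]
    simp only [mul_assoc, hfa]
    abel
  · have key : tw B 1 x.2 * f * y.2 + ((-1 : ℚ) ^ k) • (x.2 * tw B n (tw B 1 y.2 * f)) = 0 := by
      rcases Nat.even_or_odd n with hn | hn
      · simp [hf.even hn]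
      · rcases Gsh_cases hx2 with h0 | ⟨l, rfl, hl⟩
        · simp [h0]
        · rw [map_mul, tw_apply n hf.mem, (Nat.even_mul_succ_self n).neg_one_pow, one_smul,
            tw_apply 1 hl, mul_assoc, hfa, tw_odd hn, tw_odd hn, tw_tw, pow_add, hn.neg_one_pow]
          simp
    have key2 : tw B 1 x.2 * Dd B (tw B n y.1) = ((-1 : ℚ) ^ k) • (x.2 * tw B n (Dd B y.1)) := by
      rcases Gsh_cases hx2 with h0 | ⟨l, rfl, hl⟩
      · simp [h0]
      · rw [tw_Dd, tw_apply 1 hl, mul_smul_comm, smul_smul, pow_add, mul_assoc, ← mul_pow]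
        simp
    have ht' : ((-1 : ℚ) ^ k) • (x.1 * Dd B y.2) = tw B 1 x.1 * Dd B y.2 := by
      rw [← smul_mul_assoc, ht]
    simp only [snd_diff, fst_diff, snd_mul, snd_add, snd_smul, Dd_mul, map_add, add_mul,
      mul_add, key2, smul_add, ht'] at key ⊢
    rw [← sub_eq_zero, ← neg_eq_zero, ← key]
    abel

instance : GCDGA (SqExt B n f hf) where
  grading := grad B n f hf
  gradedAlgebra := mkGraded _ (mem_grad.mpr ⟨one_mem_Gr, by simp⟩)
    (by
      intro i j x hx y hy
      refine mem_grad.mpr ⟨mul_mem_Gr hx.1 hy.1, add_mem ?_ ?_⟩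
      · have := Gsh_mul ((Gsh_zero (A := B) i).symm ▸ hx.1) hy.2
        rwa [zero_add] at this
      · have := Gsh_mul hx.2 ((Gsh_zero (A := B) j).symm ▸ tw_mem n hy.1)
        rwa [add_zero] at this)
    (iSupIndep_of_eigen _ (toProd B n f hf) (fun _ _ h => h)
      ((euler B).prodMap (euler B + (n : ℚ) • LinearMap.id)) (by
        intro k x hx
        exact Prod.ext (scal_apply _ hx.1) (Gsh_euler hx.2)))
    iSup_grad
  grading_comm i j x y hx hy := by
    obtain ⟨hx1, hx2⟩ := mem_grad.mp hx
    obtain ⟨hy1, hy2⟩ := mem_grad.mp hy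
    ext
    · exact Gr_comm hx1 hy1
    · have h1 : x.1 * y.2 = ((-1 : ℚ) ^ (i * j)) • (y.2 * tw B n x.1) := by
        rcases Gsh_cases hy2 with h0 | ⟨l, rfl, hl⟩
        · simp [h0]
        · rw [Gr_comm hx1 hl, tw_apply n hx1, mul_smul_comm, smul_smul, mul_add, pow_add, mul_assoc,
            mul_comm n i, ← mul_pow]
          simp
      have h2 : x.2 * tw B n y.1 = ((-1 : ℚ) ^ (i * j)) • (y.1 * x.2) := by
        rcases Gsh_cases hx2 with h0 | ⟨l, rfl, hl⟩
        · simp [h0]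
        · rw [tw_apply n hy1, mul_smul_comm, Gr_comm hl hy1, smul_smul, add_mul, pow_add,
            mul_comm ((-1 : ℚ) ^ (n * j))]
      rw [snd_mul, snd_smul, snd_mul, h1, h2, smul_add, add_comm]
  d := diff B n f hf
  d_sq x := by
    ext
    · simp only [fst_diff, snd_diff, map_add, Dd_mul, hf.closed, tw_Dd, Dd_Dd]
      simp
    · simp [Dd_Dd]
  d_grading i x hx := by
    obtain ⟨hx1, hx2⟩ := mem_grad.mp hx
    refine mem_grad.mpr ⟨add_mem (Dd_mem hx1) ?_, Gsh_Dd hx2⟩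
    rcases Gsh_cases hx2 with h0 | ⟨l, rfl, hl⟩
    · simp [h0]
    · have := mul_mem_Gr (tw_mem 1 hl) hf.mem
      rwa [← add_assoc] at this
  d_leibniz i x y hx := leibniz hx y

theorem mem_Gr {k : ℕ} {x : SqExt B n f hf} :
    x ∈ Gr (SqExt B n f hf) k ↔ x.1 ∈ Gr B k ∧ x.2 ∈ Gsh B n k := Iff.rfl

@[simp] theorem fst_Dd (x : SqExt B n f hf) :
    (Dd (SqExt B n f hf) x).1 = Dd B x.1 + tw B 1 x.2 * f := rfl

@[simp] theorem snd_Dd (x : SqExt B n f hf) : (Dd (SqExt B n f hf) x).2 = Dd B x.2 := rfl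

theorem incl_dga : IsDGAHom (incl B n f hf) :=
  ⟨fun a => by ext <;> simp, fun _ _ ha => mem_Gr.mpr ⟨ha, by simp⟩⟩

theorem gen_mem : gen B n f hf ∈ Gr (SqExt B n f hf) n :=
  mem_Gr.mpr ⟨by simp, by simpa using mem_Gsh_add (m := n) (one_mem_Gr (A := B))⟩

theorem Dd_gen : Dd _ (gen B n f hf) = incl B n f hf f := by ext <;> simp [Dd_one]

theorem gen_sq : gen B n f hf * gen B n f hf = 0 := by ext <;> simp

theorem adjoin_gen : Algebra.adjoin ℚ (Set.range (incl B n f hf) ∪ {gen B n f hf}) = ⊤ := by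
  refine Algebra.eq_top_iff.mpr fun x => ?_
  rw [eq_incl_add x]
  have h : ∀ b, incl B n f hf b ∈
      Algebra.adjoin ℚ (Set.range (incl B n f hf) ∪ {gen B n f hf}) := fun b =>
    Algebra.subset_adjoin (Or.inl ⟨b, rfl⟩)
  exact add_mem (h _) (mul_mem (h _) (Algebra.subset_adjoin (Or.inr rfl)))

theorem tw_fst (m : ℕ) (x : SqExt B n f hf) : (tw (SqExt B n f hf) m x).1 = tw B m x.1 := by
  induction x using hom_induction with
  | hom i a ha => rw [tw_apply _ ha, fst_smul, tw_apply _ (mem_Gr.mp ha).1]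
  | add a b ha hb => simp only [map_add, fst_add, ha, hb]

theorem tw_snd (m : ℕ) (x : SqExt B n f hf) :
    (tw (SqExt B n f hf) m x).2 = ((-1 : ℚ) ^ (m * n)) • tw B m x.2 := by
  induction x using hom_induction with
  | hom i a ha =>
    rw [tw_apply _ ha, snd_smul]
    rcases Gsh_cases (mem_Gr.mp ha).2 with h0 | ⟨l, rfl, hl⟩
    · simp [h0]
    · rw [tw_apply _ hl, smul_smul, ← pow_add]; congr 2; ring
  | add a b ha hb => simp only [map_add, snd_add, ha, hb, smul_add]

variable {C : Type} [GCDGA C]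

/-- The morphism out of the extension determined by the image of the generator. -/
def lift (g : B →ₐ[ℚ] C) (hg : IsDGAHom g) (U : C) (hU : U ∈ Gr C n) (hU2 : U * U = 0) :
    SqExt B n f hf →ₐ[ℚ] C :=
  AlgHom.ofLinearMap
    { toFun := fun x => g x.1 + g x.2 * U
      map_add' := fun x y => by simp [add_mul]; abel
      map_smul' := fun q x => by simp }
    (by simp)
    (by
      intro x y
      have h : ∀ b, U * g b = g (tw B n b) * U := fun b => by
        rw [map_tw g hg.2, mul_eq_tw_mul hU]
      have e1 : g x.2 * U * g y.1 = g x.2 * g (tw B n y.1) * U := by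
        rw [mul_assoc, h, mul_assoc]
      have e2 : g x.2 * U * (g y.2 * U) = 0 := by
        rw [mul_assoc, ← mul_assoc U, h, mul_assoc _ U U, hU2]; simp
      change g (x.1 * y.1) + g (x.1 * y.2 + x.2 * tw B n y.1) * U =
        (g x.1 + g x.2 * U) * (g y.1 + g y.2 * U)
      rw [mul_add, add_mul, add_mul, e1, e2]
      simp only [map_mul, map_add, add_mul, mul_assoc]
      abel)

section Lift

variable (g : B →ₐ[ℚ] C) (hg : IsDGAHom g) (U : C) (hU : U ∈ Gr C n) (hU2 : U * U = 0)

theorem lift_apply (x : SqExt B n f hf) : lift g hg U hU hU2 x = g x.1 + g x.2 * U := rfl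

@[simp] theorem lift_incl (b : B) : lift g hg U hU hU2 (incl B n f hf b) = g b := by
  simp [lift_apply]

@[simp] theorem lift_gen : lift g hg U hU hU2 (gen B n f hf) = U := by
  simp [lift_apply]

theorem lift_dga (hd : Dd C U = g f) : IsDGAHom (lift (hf := hf) g hg U hU hU2) := by
  refine ⟨fun x => ?_, fun i x hx => ?_⟩
  · simp only [lift_apply, fst_Dd, snd_Dd, map_add, map_mul, Dd_mul, hd, hg.1, map_tw g hg.2]
    abel
  · obtain ⟨h1, h2⟩ := mem_Gr.mp hx
    refine add_mem (hg.2 _ _ h1) ?_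
    rcases Gsh_cases h2 with h0 | ⟨l, rfl, hl⟩
    · simp [h0]
    · exact mul_mem_Gr (hg.2 _ _ hl) hU

end Lift

end SqExt

end SqExt

section PolyExt

open Polynomial

/-- The extension `B[x]` with `x` closed of even degree `n`. -/
def PolyExt (B : Type) [GCDGA B] (n : ℕ) (_ : Even n) : Type := B[X]

namespace PolyExt

variable {B : Type} [GCDGA B] {n : ℕ} {hn : Even n}

instance : Ring (PolyExt B n hn) := inferInstanceAs (Ring B[X])

instance : Algebra ℚ (PolyExt B n hn) := inferInstanceAs (Algebra ℚ B[X])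

/-- The coefficients. -/
def coef (k : ℕ) : PolyExt B n hn →ₗ[ℚ] B where
  toFun p := Polynomial.coeff (R := B) p k
  map_add' p q := Polynomial.coeff_add (R := B) p q k
  map_smul' c p := Polynomial.coeff_smul (R := B) c p k

@[ext] theorem ext {p q : PolyExt B n hn} (h : ∀ k, coef k p = coef k q) : p = q :=
  Polynomial.ext (R := B) h

/-- The monomials. -/
def mon (k : ℕ) : B →ₗ[ℚ] PolyExt B n hn where
  toFun b := Polynomial.monomial (R := B) k b
  map_add' p q := map_add (Polynomial.monomial (R := B) k) p q
  map_smul' c p := (Polynomial.smul_monomial (R := B) c k p).symm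

theorem coef_mon (k l : ℕ) (b : B) :
    coef l (mon (hn := hn) k b) = if k = l then b else 0 :=
  Polynomial.coeff_monomial (R := B)

theorem coef_mul (p q : PolyExt B n hn) (k : ℕ) :
    coef k (p * q) = ∑ x ∈ Finset.HasAntidiagonal.antidiagonal k, coef x.1 p * coef x.2 q :=
  Polynomial.coeff_mul (R := B) p q k

theorem coef_one (k : ℕ) : coef k (1 : PolyExt B n hn) = if k = 0 then 1 else 0 :=
  Polynomial.coeff_one (R := B)

theorem induction {P : PolyExt B n hn → Prop} (mon : ∀ k b, P (mon k b))
    (add : ∀ p q, P p → P q → P (p + q)) (p : PolyExt B n hn) : P p :=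
  Polynomial.induction_on' (R := B) p add mon

theorem mon_mul_mon (k l : ℕ) (a b : B) :
    mon (hn := hn) k a * mon l b = mon (k + l) (a * b) :=
  Polynomial.monomial_mul_monomial (R := B) k l a b

theorem exists_sum_mon (p : PolyExt B n hn) : ∃ s : Finset ℕ, p = ∑ k ∈ s, mon k (coef k p) :=
  ⟨_, Polynomial.as_sum_support (R := B) p⟩

/-- The linear map determined by its values on monomials. -/
def lsum {M : Type} [AddCommGroup M] [Module ℚ M] (φ : ℕ → B →ₗ[ℚ] M) :
    PolyExt B n hn →ₗ[ℚ] M :=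
  Polynomial.lsum (A := B) φ

theorem lsum_mon {M : Type} [AddCommGroup M] [Module ℚ M] (φ : ℕ → B →ₗ[ℚ] M) (k : ℕ) (b : B) :
    lsum (hn := hn) φ (mon k b) = φ k b :=
  Polynomial.sum_monomial_index (S := M) b (fun i a => φ i a) (map_zero _)

/-- The differential, acting coefficientwise. -/
def diff : PolyExt B n hn →ₗ[ℚ] PolyExt B n hn := lsum fun k => mon k ∘ₗ Dd B

theorem diff_mon (k : ℕ) (b : B) : diff (mon (hn := hn) k b) = mon k (Dd B b) := lsum_mon _ k b

theorem coef_diff (k : ℕ) (p : PolyExt B n hn) : coef k (diff p) = Dd B (coef k p) := by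
  induction p using PolyExt.induction with
  | mon l b => rw [diff_mon, coef_mon, coef_mon]; split_ifs <;> simp
  | add p q hp hq => simp only [map_add, hp, hq]

variable (B n hn) in
/-- The grading. -/
def grad (k : ℕ) : Submodule ℚ (PolyExt B n hn) := ⨅ i, (Gsh B (n * i) k).comap (coef i)

theorem mem_grad {k : ℕ} {p : PolyExt B n hn} :
    p ∈ grad B n hn k ↔ ∀ i, coef i p ∈ Gsh B (n * i) k := by
  simp [grad, Submodule.mem_iInf]

theorem mon_mem_grad {l k : ℕ} {b : B} (hb : b ∈ Gr B k) :
    mon (hn := hn) l b ∈ grad B n hn (k + n * l) := by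
  refine mem_grad.mpr fun i => ?_
  rw [coef_mon]
  split_ifs with h
  · exact h ▸ mem_Gsh_add hb
  · exact zero_mem _

theorem iSup_grad : ⨆ k, grad B n hn k = ⊤ := by
  refine Submodule.eq_top_iff'.mpr fun x => ?_
  induction x using PolyExt.induction with
  | mon l b =>
    induction b using hom_induction with
    | hom i a ha => exact Submodule.mem_iSup_of_mem _ (mon_mem_grad ha)
    | add a b ha hb => rw [map_add]; exact add_mem ha hb
  | add p q hp hq => exact add_mem hp hq

theorem Gsh_comm {i j k l : ℕ} (hn : Even n) {a b : B} (ha : a ∈ Gsh B (n * k) i)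
    (hb : b ∈ Gsh B (n * l) j) : a * b = ((-1 : ℚ) ^ (i * j)) • (b * a) := by
  rcases Gsh_cases ha with rfl | ⟨i', rfl, hi⟩
  · simp
  rcases Gsh_cases hb with rfl | ⟨j', rfl, hj⟩
  · simp
  have he : Even (i' * (n * l) + n * k * (j' + n * l)) :=
    ((hn.mul_right l).mul_left i').add ((hn.mul_right k).mul_right _)
  rw [Gr_comm hi hj, show (i' + n * k) * (j' + n * l) =
    i' * j' + (i' * (n * l) + n * k * (j' + n * l)) by ring, pow_add, he.neg_one_pow, mul_one]

theorem Gsh_tw {i k : ℕ} (hn : Even n) {a : B} (ha : a ∈ Gsh B (n * k) i) :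
    tw B 1 a = ((-1 : ℚ) ^ i) • a := by
  rcases Gsh_cases ha with rfl | ⟨i', rfl, hi⟩
  · simp
  rw [tw_apply _ hi, pow_add, (hn.mul_right k).neg_one_pow, mul_one, one_mul]

instance : GCDGA (PolyExt B n hn) where
  grading := grad B n hn
  gradedAlgebra := mkGraded _
    (by
      refine mem_grad.mpr fun i => ?_
      rw [coef_one]
      split_ifs with h
      · subst h; simpa [Gsh_zero] using one_mem_Gr
      · exact zero_mem _)
    (by
      intro i j p hp q hq
      refine mem_grad.mpr fun k => ?_
      rw [coef_mul]
      refine sum_mem fun x hx => ?_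
      rw [← Finset.HasAntidiagonal.mem_antidiagonal.mp hx, mul_add]
      exact Gsh_mul (mem_grad.mp hp _) (mem_grad.mp hq _))
    (iSupIndep_of_eigen _ (LinearMap.pi fun k => coef k) (fun p q h => ext fun k => congrFun h k)
      (LinearMap.pi fun k => (euler B + ((n * k : ℕ) : ℚ) • LinearMap.id) ∘ₗ LinearMap.proj k) (by
        intro k p hp
        funext i
        exact Gsh_euler (mem_grad.mp hp i)))
    iSup_grad
  grading_comm i j p q hp hq := by
    ext k
    rw [map_smul, coef_mul, coef_mul, Finset.smul_sum, ← Finset.Nat.sum_antidiagonal_swap]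
    exact Finset.sum_congr rfl fun x _ => Gsh_comm hn (mem_grad.mp hp _) (mem_grad.mp hq _)
  d := diff
  d_sq p := by ext k; rw [coef_diff, coef_diff, Dd_Dd, map_zero]
  d_grading i p hp := mem_grad.mpr fun k => by
    rw [coef_diff]; exact Gsh_Dd (mem_grad.mp hp k)
  d_leibniz i p q hp := by
    ext k
    rw [coef_diff, map_add, map_smul, coef_mul, coef_mul, coef_mul, Finset.smul_sum, map_sum,
      ← Finset.sum_add_distrib]
    refine Finset.sum_congr rfl fun x _ => ?_
    rw [coef_diff, coef_diff, Dd_mul, Gsh_tw hn (mem_grad.mp hp _), smul_mul_assoc]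

theorem mem_Gr {k : ℕ} {p : PolyExt B n hn} :
    p ∈ Gr (PolyExt B n hn) k ↔ ∀ i, coef i p ∈ Gsh B (n * i) k := mem_grad

theorem Dd_mon (k : ℕ) (b : B) : Dd _ (mon (hn := hn) k b) = mon k (Dd B b) := diff_mon k b

theorem mon_mem {l k : ℕ} {b : B} (hb : b ∈ Gr B k) :
    mon l b ∈ Gr (PolyExt B n hn) (k + n * l) := mon_mem_grad hb

theorem mon_zero_one : mon 0 1 = (1 : PolyExt B n hn) :=
  ext fun k => by rw [coef_mon, coef_one]; simp only [eq_comm]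

variable (B n hn) in
/-- The inclusion of the base. -/
def incl : B →ₐ[ℚ] PolyExt B n hn :=
  AlgHom.ofLinearMap (mon 0) mon_zero_one fun a b => by rw [mon_mul_mon]

variable (B n hn) in
/-- The polynomial generator. -/
def gen : PolyExt B n hn := mon 1 1

theorem incl_eq (b : B) : incl B n hn b = mon 0 b := rfl

theorem incl_dga : IsDGAHom (incl B n hn) :=
  ⟨fun a => (Dd_mon 0 a).symm, fun i a ha => by
    have h := mon_mem (hn := hn) (l := 0) ha
    rwa [mul_zero, add_zero] at h⟩

theorem gen_mem : gen B n hn ∈ Gr (PolyExt B n hn) n := by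
  have h := mon_mem (hn := hn) (l := 1) (one_mem_Gr (A := B))
  rwa [zero_add, mul_one] at h

theorem Dd_gen : Dd _ (gen B n hn) = 0 := by rw [gen, Dd_mon, Dd_one, map_zero]

theorem gen_pow (k : ℕ) : gen B n hn ^ k = mon k 1 := by
  induction k with
  | zero => rfl
  | succ k ih => rw [pow_succ, ih, gen, mon_mul_mon, one_mul]

theorem mon_eq (k : ℕ) (b : B) : mon k b = incl B n hn b * gen B n hn ^ k := by
  rw [gen_pow, incl_eq, mon_mul_mon, zero_add, mul_one]

theorem adjoin_gen :
    Algebra.adjoin ℚ (Set.range (incl B n hn) ∪ {gen B n hn} : Set (PolyExt B n hn)) = ⊤ := by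
  refine Algebra.eq_top_iff.mpr fun x => ?_
  have hg : gen B n hn ∈
      Algebra.adjoin ℚ (Set.range (incl B n hn) ∪ {gen B n hn} : Set (PolyExt B n hn)) :=
    Algebra.subset_adjoin (Or.inr rfl)
  induction x using PolyExt.induction with
  | mon k b =>
    rw [mon_eq]
    exact mul_mem (Algebra.subset_adjoin (Or.inl ⟨b, rfl⟩)) (Subalgebra.pow_mem _ hg k)
  | add p q hp hq => exact add_mem hp hq

variable {C : Type} [GCDGA C]

/-- The morphism out of the extension determined by the image of the generator. -/
def lift (hn : Even n) (g : B →ₐ[ℚ] C) (U : C) (hU : U ∈ Gr C n) : PolyExt B n hn →ₐ[ℚ] C :=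
  AlgHom.ofLinearMap (lsum fun k => LinearMap.mulRight ℚ (U ^ k) ∘ₗ g.toLinearMap)
    (by
      have : (1 : PolyExt B n hn) = mon 0 1 := rfl
      rw [this, lsum_mon]; simp)
    (by
      intro p q
      induction p using PolyExt.induction with
      | mon k a =>
        induction q using PolyExt.induction with
        | mon l b =>
          have h : U ^ k * g b = g b * U ^ k :=
            ((show Commute U (g b) from even_mul_comm hn hU _).pow_left k).eq
          rw [mon_mul_mon, lsum_mon, lsum_mon, lsum_mon]
          simp only [LinearMap.comp_apply, AlgHom.toLinearMap_apply, LinearMap.mulRight_apply,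
            map_mul, pow_add]
          rw [mul_assoc, ← mul_assoc (g b), ← h]
          simp only [mul_assoc]
        | add p q hp hq => simp only [mul_add, map_add, hp, hq]
      | add p q hp hq => simp only [add_mul, map_add, hp, hq])

section Lift

variable (g : B →ₐ[ℚ] C) (U : C) (hU : U ∈ Gr C n)

theorem lift_mon (k : ℕ) (b : B) : lift hn g U hU (mon k b) = g b * U ^ k := lsum_mon _ k b

@[simp] theorem lift_incl (b : B) : lift hn g U hU (incl B n hn b) = g b := by
  rw [incl_eq, lift_mon, pow_zero, mul_one]

@[simp] theorem lift_gen : lift hn g U hU (gen B n hn) = U := by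
  rw [gen, lift_mon, map_one, one_mul, pow_one]

theorem lift_dga (hg : IsDGAHom g) (hd : Dd C U = 0) : IsDGAHom (lift hn g U hU) := by
  have hp : ∀ k, U ^ k ∈ Gr C (n * k) := fun k => by
    induction k with
    | zero => simpa using one_mem_Gr
    | succ k ih => rw [pow_succ, mul_add, mul_one]; exact mul_mem_Gr ih hU
  have hdp : ∀ k, Dd C (U ^ k) = 0 := fun k => by
    induction k with
    | zero => simpa using Dd_one
    | succ k ih => rw [pow_succ]; exact Dd_mul_closed ih hd
  refine ⟨fun p => ?_, fun i p hi => ?_⟩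
  · induction p using PolyExt.induction with
    | mon k b => rw [Dd_mon, lift_mon, lift_mon, Dd_mul, hdp, hg.1]; simp
    | add p q hp hq => simp only [map_add, hp, hq]
  · obtain ⟨s, hs⟩ := exists_sum_mon p
    rw [hs, map_sum]
    refine sum_mem fun k _ => ?_
    rw [lift_mon]
    rcases Gsh_cases (mem_Gr.mp hi k) with h0 | ⟨l, rfl, hl⟩
    · rw [h0, map_zero, zero_mul]; exact zero_mem _
    · exact mul_mem_Gr (hg.2 _ _ hl) (hp k)

end Lift

end PolyExt

end PolyExt

section Factor

variable {M N P : Type} [AddCommGroup M] [Module ℚ M] [AddCommGroup N] [Module ℚ N]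
  [AddCommGroup P] [Module ℚ P]

/-- Factorization of a linear map through a surjective one. -/
def factorLin (f : M →ₗ[ℚ] N) (hf : Function.Surjective f) (g : M →ₗ[ℚ] P)
    (h : ∀ a, f a = 0 → g a = 0) : N →ₗ[ℚ] P :=
  have key : ∀ a b, f a = f b → g a = g b := fun a b hab => by
    rw [← sub_eq_zero, ← map_sub]; exact h _ (by rw [map_sub, hab, sub_self])
  { toFun := fun x => g (Function.surjInv hf x)
    map_add' := fun x y => by
      rw [← map_add]; apply key; simp only [map_add, Function.surjInv_eq]
    map_smul' := fun c x => by
      rw [← map_smul]; apply key; simp only [map_smul, Function.surjInv_eq, RingHom.id_apply] }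

theorem factorLin_apply (f : M →ₗ[ℚ] N) (hf : Function.Surjective f) (g : M →ₗ[ℚ] P)
    (h : ∀ a, f a = 0 → g a = 0) (a : M) : factorLin f hf g h (f a) = g a := by
  change g (Function.surjInv hf (f a)) = g a
  rw [← sub_eq_zero, ← map_sub]
  exact h _ (by rw [map_sub, Function.surjInv_eq hf, sub_self])

/-- Factorization of an algebra morphism through a surjective one. -/
def factorAlg {M N P : Type} [Ring M] [Algebra ℚ M] [Ring N] [Algebra ℚ N] [Ring P] [Algebra ℚ P]
    (f : M →ₐ[ℚ] N) (hf : Function.Surjective f) (g : M →ₐ[ℚ] P)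
    (h : ∀ a, f a = 0 → g a = 0) : N →ₐ[ℚ] P :=
  AlgHom.ofLinearMap (factorLin f.toLinearMap hf g.toLinearMap h)
    (by
      have := factorLin_apply f.toLinearMap hf g.toLinearMap h 1
      simpa using this)
    (fun x y => by
      obtain ⟨x, rfl⟩ := hf x
      obtain ⟨y, rfl⟩ := hf y
      have := factorLin_apply f.toLinearMap hf g.toLinearMap h
      simp only [AlgHom.toLinearMap_apply] at this
      rw [← map_mul, this, this, this, map_mul])

theorem factorAlg_apply {M N P : Type} [Ring M] [Algebra ℚ M] [Ring N] [Algebra ℚ N] [Ring P]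
    [Algebra ℚ P] (f : M →ₐ[ℚ] N) (hf : Function.Surjective f) (g : M →ₐ[ℚ] P)
    (h : ∀ a, f a = 0 → g a = 0) (a : M) : factorAlg f hf g h (f a) = g a :=
  factorLin_apply f.toLinearMap hf g.toLinearMap h a

end Factor

section Quot

/-- Two-sided ideals stable under the Euler derivation and the differential. -/
structure DGIdeal (T : Type) [GCDGA T] where
  carrier : Ideal T
  mul_right : ∀ a ∈ carrier, ∀ b, a * b ∈ carrier
  euler_mem : ∀ a ∈ carrier, euler T a ∈ carrier
  Dd_mem : ∀ a ∈ carrier, Dd T a ∈ carrier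

/-- The quotient by a differential graded ideal. -/
def DGQuot (T : Type) [GCDGA T] (I : DGIdeal T) : Type := T ⧸ I.carrier

namespace DGQuot

variable {T : Type} [GCDGA T] {I : DGIdeal T}

instance : I.carrier.IsTwoSided := ⟨fun b ha => I.mul_right _ ha b⟩

instance : Ring (DGQuot T I) := inferInstanceAs (Ring (T ⧸ I.carrier))

instance : Algebra ℚ (DGQuot T I) := inferInstanceAs (Algebra ℚ (T ⧸ I.carrier))

variable (T I) in
/-- The projection onto the quotient. -/
def mk : T →ₐ[ℚ] DGQuot T I := Ideal.Quotient.mkₐ ℚ I.carrier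

theorem mk_surjective : Function.Surjective (mk T I) := Ideal.Quotient.mk_surjective

theorem mk_eq_zero {a : T} : mk T I a = 0 ↔ a ∈ I.carrier := Ideal.Quotient.eq_zero_iff_mem

/-- The linear endomorphism induced on the quotient. -/
def desc (L : T →ₗ[ℚ] T) (hL : ∀ a ∈ I.carrier, L a ∈ I.carrier) :
    DGQuot T I →ₗ[ℚ] DGQuot T I :=
  factorLin (mk T I).toLinearMap mk_surjective ((mk T I).toLinearMap ∘ₗ L)
    fun a ha => mk_eq_zero.mpr (hL a (mk_eq_zero.mp ha))

theorem desc_mk (L : T →ₗ[ℚ] T) (hL : ∀ a ∈ I.carrier, L a ∈ I.carrier) (a : T) :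
    desc L hL (mk T I a) = mk T I (L a) :=
  factorLin_apply (mk T I).toLinearMap mk_surjective ((mk T I).toLinearMap ∘ₗ L) _ a

instance : GCDGA (DGQuot T I) where
  grading k := (Gr T k).map (mk T I).toLinearMap
  gradedAlgebra := mkGraded _ ⟨1, one_mem_Gr, map_one (mk T I)⟩
    (by
      rintro i j _ ⟨a, ha, rfl⟩ _ ⟨b, hb, rfl⟩
      exact ⟨a * b, mul_mem_Gr ha hb, map_mul (mk T I) a b⟩)
    (iSupIndep_of_eigen _ LinearMap.id Function.injective_id (desc (euler T) I.euler_mem) (by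
      rintro k _ ⟨a, ha, rfl⟩
      change desc _ _ (mk T I a) = (k : ℚ) • mk T I a
      rw [desc_mk, scal_apply _ ha, map_smul]))
    (by
      rw [← Submodule.map_iSup, iSup_Gr, Submodule.map_top]
      exact LinearMap.range_eq_top.mpr mk_surjective)
  grading_comm := by
    rintro i j _ _ ⟨a, ha, rfl⟩ ⟨b, hb, rfl⟩
    change mk T I a * mk T I b = _ • (mk T I b * mk T I a)
    rw [← map_mul, Gr_comm ha hb, map_smul, map_mul]
  d := desc (Dd T) I.Dd_mem
  d_sq x := by
    obtain ⟨a, rfl⟩ := mk_surjective x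
    rw [desc_mk, desc_mk, Dd_Dd, map_zero]
  d_grading := by
    rintro i _ ⟨a, ha, rfl⟩
    exact ⟨Dd T a, Dd_mem ha, (desc_mk (I := I) (Dd T) I.Dd_mem a).symm⟩
  d_leibniz := by
    rintro i _ y ⟨a, ha, rfl⟩
    obtain ⟨b, rfl⟩ := mk_surjective y
    change desc _ _ (mk T I a * mk T I b) =
      desc _ _ (mk T I a) * mk T I b + _ • (mk T I a * desc _ _ (mk T I b))
    rw [← map_mul, desc_mk, desc_mk, desc_mk, Dd_mul, tw_apply _ ha, one_mul]
    simp

theorem mk_dga : IsDGAHom (mk T I) :=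
  ⟨fun a => (desc_mk (I := I) (Dd T) I.Dd_mem a).symm, fun _ a ha => ⟨a, ha, rfl⟩⟩

end DGQuot

section KerPow

variable {T A : Type} [GCDGA T] [GCDGA A] (m : T →ₐ[ℚ] A)

/-- The kernel of a morphism. -/
abbrev kerLin : Submodule ℚ T := LinearMap.ker m.toLinearMap

theorem mem_kerLin {a : T} : a ∈ kerLin m ↔ m a = 0 := Iff.rfl

theorem mul_mem_kerPow (n : ℕ) (t : T) {a : T} (ha : a ∈ kerLin m ^ (n + 1)) :
    t * a ∈ kerLin m ^ (n + 1) := by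
  induction n generalizing a with
  | zero =>
    rw [zero_add, pow_one, mem_kerLin] at *
    rw [map_mul, ha, mul_zero]
  | succ n ih =>
    rw [pow_succ] at ha ⊢
    induction ha using Submodule.mul_induction_on' with
    | mem_mul_mem x hx y hy => rw [← mul_assoc]; exact Submodule.mul_mem_mul (ih hx) hy
    | add x _ y _ hx hy => rw [mul_add]; exact add_mem hx hy

theorem kerPow_mul_mem (n : ℕ) (t : T) {a : T} (ha : a ∈ kerLin m ^ (n + 1)) :
    a * t ∈ kerLin m ^ (n + 1) := by
  have key : ∀ y ∈ kerLin m, y * t ∈ kerLin m := fun y hy => by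
    rw [mem_kerLin] at *
    rw [map_mul, hy, zero_mul]
  rw [pow_succ] at ha ⊢
  induction ha using Submodule.mul_induction_on' with
  | mem_mul_mem x hx y hy => rw [mul_assoc]; exact Submodule.mul_mem_mul hx (key y hy)
  | add x _ y _ hx hy => rw [add_mul]; exact add_mem hx hy

variable {m}

theorem tw_mem_kerPow (hm : IsDGAHom m) (n : ℕ) {a : T} (ha : a ∈ kerLin m ^ n) :
    tw T 1 a ∈ kerLin m ^ n := by
  have h : kerLin m ≤ (kerLin m).comap (tw T 1).toLinearMap := fun y hy => by
    change m (tw T 1 y) = 0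
    rw [map_tw m hm.2, (mem_kerLin m).mp hy, map_zero]
  induction n generalizing a with
  | zero =>
    rw [pow_zero] at *
    obtain ⟨q, rfl⟩ := Submodule.mem_one.mp ha
    rw [AlgHom.commutes]; exact ha
  | succ n ih =>
    rw [pow_succ] at ha ⊢
    induction ha using Submodule.mul_induction_on' with
    | mem_mul_mem x hx y hy => rw [map_mul]; exact Submodule.mul_mem_mul (ih hx) (h hy)
    | add x _ y _ hx hy => rw [map_add]; exact add_mem hx hy

theorem euler_mem_kerPow (hm : IsDGAHom m) (n : ℕ) {a : T} (ha : a ∈ kerLin m ^ (n + 1)) :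
    euler T a ∈ kerLin m ^ (n + 1) := by
  have h : ∀ y ∈ kerLin m, euler T y ∈ kerLin m := fun y hy => by
    rw [mem_kerLin] at *
    rw [map_scal m hm.2, hy, map_zero]
  induction n generalizing a with
  | zero => rw [zero_add, pow_one] at *; exact h a ha
  | succ n ih =>
    rw [pow_succ] at ha ⊢
    induction ha using Submodule.mul_induction_on' with
    | mem_mul_mem x hx y hy =>
      rw [euler_mul]
      exact add_mem (Submodule.mul_mem_mul (ih hx) hy) (Submodule.mul_mem_mul hx (h y hy))
    | add x _ y _ hx hy => rw [map_add]; exact add_mem hx hy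

theorem Dd_mem_kerPow (hm : IsDGAHom m) (n : ℕ) {a : T} (ha : a ∈ kerLin m ^ (n + 1)) :
    Dd T a ∈ kerLin m ^ (n + 1) := by
  have h : ∀ y ∈ kerLin m, Dd T y ∈ kerLin m := fun y hy => by
    rw [mem_kerLin] at *
    rw [hm.1, hy, map_zero]
  induction n generalizing a with
  | zero => rw [zero_add, pow_one] at *; exact h a ha
  | succ n ih =>
    rw [pow_succ] at ha ⊢
    induction ha using Submodule.mul_induction_on' with
    | mem_mul_mem x hx y hy =>
      rw [Dd_mul]
      exact add_mem (Submodule.mul_mem_mul (ih hx) hy)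
        (Submodule.mul_mem_mul (tw_mem_kerPow hm _ hx) (h y hy))
    | add x _ y _ hx hy => rw [map_add]; exact add_mem hx hy

/-- The powers of the kernel of a morphism, as differential graded ideals. -/
def kerPow (hm : IsDGAHom m) (n : ℕ) : DGIdeal T where
  carrier :=
    { kerLin m ^ (n + 1) with
      smul_mem' := fun t _ ha => mul_mem_kerPow m n t ha }
  mul_right _ ha b := kerPow_mul_mem m n b ha
  euler_mem _ ha := euler_mem_kerPow hm n ha
  Dd_mem _ ha := Dd_mem_kerPow hm n ha

theorem ker_mk_kerPow (hm : IsDGAHom m) (n : ℕ) :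
    kerLin (DGQuot.mk T (kerPow hm n)) = kerLin m ^ (n + 1) :=
  Submodule.ext fun _ => DGQuot.mk_eq_zero

end KerPow

end Quot

section Pullback

/-- The pullback of two morphisms. -/
def Pull {T Q D : Type} [GCDGA T] [GCDGA Q] [GCDGA D] (φ : T →ₐ[ℚ] D) (ψ : Q →ₐ[ℚ] D)
    (_ : IsDGAHom φ) (_ : IsDGAHom ψ) : Type :=
  AlgHom.equalizer (φ.comp (AlgHom.fst ℚ T Q)) (ψ.comp (AlgHom.snd ℚ T Q))

namespace Pull

variable {T Q D : Type} [GCDGA T] [GCDGA Q] [GCDGA D] {φ : T →ₐ[ℚ] D} {ψ : Q →ₐ[ℚ] D}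
  {hφ : IsDGAHom φ} {hψ : IsDGAHom ψ}

instance : Ring (Pull φ ψ hφ hψ) :=
  inferInstanceAs (Ring (AlgHom.equalizer (φ.comp (AlgHom.fst ℚ T Q)) (ψ.comp (AlgHom.snd ℚ T Q))))

instance : Algebra ℚ (Pull φ ψ hφ hψ) :=
  inferInstanceAs
    (Algebra ℚ (AlgHom.equalizer (φ.comp (AlgHom.fst ℚ T Q)) (ψ.comp (AlgHom.snd ℚ T Q))))

variable (φ ψ hφ hψ) in
/-- The inclusion in the product. -/
def val : Pull φ ψ hφ hψ →ₐ[ℚ] T × Q := Subalgebra.val _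

theorem val_injective : Function.Injective (val φ ψ hφ hψ) := Subtype.val_injective

variable (φ ψ hφ hψ) in
/-- The first projection. -/
def fst : Pull φ ψ hφ hψ →ₐ[ℚ] T := (AlgHom.fst ℚ T Q).comp (val φ ψ hφ hψ)

variable (φ ψ hφ hψ) in
/-- The second projection. -/
def snd : Pull φ ψ hφ hψ →ₐ[ℚ] Q := (AlgHom.snd ℚ T Q).comp (val φ ψ hφ hψ)

theorem condition (x : Pull φ ψ hφ hψ) : φ (fst φ ψ hφ hψ x) = ψ (snd φ ψ hφ hψ x) := x.2

variable (φ ψ hφ hψ) in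
/-- Constructor of elements. -/
def mk (t : T) (q : Q) (h : φ t = ψ q) : Pull φ ψ hφ hψ := ⟨(t, q), h⟩

@[simp] theorem fst_mk (t : T) (q : Q) (h : φ t = ψ q) : fst φ ψ hφ hψ (mk φ ψ hφ hψ t q h) = t :=
  rfl

@[simp] theorem snd_mk (t : T) (q : Q) (h : φ t = ψ q) : snd φ ψ hφ hψ (mk φ ψ hφ hψ t q h) = q :=
  rfl

@[ext] theorem ext {x y : Pull φ ψ hφ hψ} (h₁ : fst φ ψ hφ hψ x = fst φ ψ hφ hψ y)
    (h₂ : snd φ ψ hφ hψ x = snd φ ψ hφ hψ y) : x = y :=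
  val_injective (Prod.ext h₁ h₂)

/-- The pair of endomorphisms, compatible over the base, induced on the pullback. -/
def endo (L : T →ₗ[ℚ] T) (M : Q →ₗ[ℚ] Q) (N : D →ₗ[ℚ] D) (hL : ∀ t, φ (L t) = N (φ t))
    (hM : ∀ q, ψ (M q) = N (ψ q)) : Pull φ ψ hφ hψ →ₗ[ℚ] Pull φ ψ hφ hψ where
  toFun x := mk φ ψ hφ hψ (L (fst φ ψ hφ hψ x)) (M (snd φ ψ hφ hψ x))
    (by rw [hL, hM, condition])
  map_add' x y := by ext <;> simp
  map_smul' c x := by ext <;> simp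

variable (φ ψ hφ hψ) in
/-- The grading of the pullback. -/
def grad (k : ℕ) : Submodule ℚ (Pull φ ψ hφ hψ) :=
  ((Gr T k).prod (Gr Q k)).comap (val φ ψ hφ hψ).toLinearMap

theorem mem_grad {k : ℕ} {x : Pull φ ψ hφ hψ} : x ∈ grad φ ψ hφ hψ k ↔
    fst φ ψ hφ hψ x ∈ Gr T k ∧ snd φ ψ hφ hψ x ∈ Gr Q k := Iff.rfl

theorem iSup_grad : ⨆ k, grad φ ψ hφ hψ k = ⊤ := by
  refine Submodule.eq_top_iff'.mpr fun x => ?_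
  let c : ℕ → Pull φ ψ hφ hψ := fun k =>
    endo (scal T (Pi.single k 1)) (scal Q (Pi.single k 1)) (scal D (Pi.single k 1))
      (map_scal φ hφ.2 _) (map_scal ψ hψ.2 _) x
  obtain ⟨n, hn⟩ := exists_sum_components (fst φ ψ hφ hψ x)
  obtain ⟨n', hn'⟩ := exists_sum_components (snd φ ψ hφ hψ x)
  have hx : x = ∑ k ∈ Finset.range (n + n'), c k := by
    ext
    · rw [map_sum]; exact (hn _ (by omega)).symm
    · rw [map_sum]; exact (hn' _ (by omega)).symm
  rw [hx]
  exact sum_mem fun k _ => Submodule.mem_iSup_of_mem k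
    (mem_grad.mpr ⟨scal_single_mem k _, scal_single_mem k _⟩)

instance : GCDGA (Pull φ ψ hφ hψ) where
  grading := grad φ ψ hφ hψ
  gradedAlgebra := mkGraded _ (mem_grad.mpr ⟨one_mem_Gr, one_mem_Gr⟩)
    (fun i j x hx y hy => mem_grad.mpr
      ⟨mul_mem_Gr (mem_grad.mp hx).1 (mem_grad.mp hy).1,
        mul_mem_Gr (mem_grad.mp hx).2 (mem_grad.mp hy).2⟩)
    (iSupIndep_of_eigen _ (val φ ψ hφ hψ).toLinearMap val_injective
      ((euler T).prodMap (euler Q)) (by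
        intro k x hx
        exact Prod.ext (scal_apply _ (mem_grad.mp hx).1) (scal_apply _ (mem_grad.mp hx).2)))
    iSup_grad
  grading_comm i j x y hx hy := by
    ext
    · rw [map_smul, map_mul, map_mul]; exact Gr_comm (mem_grad.mp hx).1 (mem_grad.mp hy).1
    · rw [map_smul, map_mul, map_mul]; exact Gr_comm (mem_grad.mp hx).2 (mem_grad.mp hy).2
  d := endo (Dd T) (Dd Q) (Dd D) hφ.1 hψ.1
  d_sq x := by
    ext
    · exact Dd_Dd _
    · exact Dd_Dd _
  d_grading i x hx := mem_grad.mpr ⟨Dd_mem (mem_grad.mp hx).1, Dd_mem (mem_grad.mp hx).2⟩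
  d_leibniz i x y hx := by
    ext
    · exact GCDGA.d_leibniz i _ _ (mem_grad.mp hx).1
    · exact GCDGA.d_leibniz i _ _ (mem_grad.mp hx).2

theorem fst_dga : IsDGAHom (fst φ ψ hφ hψ) := ⟨fun _ => rfl, fun _ _ h => (mem_grad.mp h).1⟩

theorem snd_dga : IsDGAHom (snd φ ψ hφ hψ) := ⟨fun _ => rfl, fun _ _ h => (mem_grad.mp h).2⟩

/-- The morphism to the pullback induced by a commutative triangle. -/
def section₁ (ρ : T →ₐ[ℚ] Q) (h : ψ.comp ρ = φ) : T →ₐ[ℚ] Pull φ ψ hφ hψ where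
  toFun t := mk φ ψ hφ hψ t (ρ t) (by rw [← h]; rfl)
  map_one' := by ext <;> simp
  map_zero' := by ext <;> simp
  map_mul' x y := by ext <;> simp
  map_add' x y := by ext <;> simp
  commutes' c := by
    ext
    · rw [fst_mk, AlgHom.commutes]
    · rw [snd_mk, AlgHom.commutes, AlgHom.commutes]

theorem section₁_dga (ρ : T →ₐ[ℚ] Q) (hρ : IsDGAHom ρ) (h : ψ.comp ρ = φ) :
    IsDGAHom (section₁ (hφ := hφ) (hψ := hψ) ρ h) := by
  refine ⟨fun t => ?_, fun i t ht => mem_grad.mpr ⟨ht, hρ.2 i t ht⟩⟩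
  ext
  · rfl
  · exact hρ.1 t

end Pull

/-- Surjective morphisms with acyclic kernel. -/
structure AcyclicSurj {T D : Type} [GCDGA T] [GCDGA D] (φ : T →ₐ[ℚ] D) : Prop where
  dga : IsDGAHom φ
  surj : Function.Surjective φ
  acyclic : ∀ t, φ t = 0 → Dd T t = 0 → ∃ e, φ e = 0 ∧ Dd T e = t

theorem AcyclicSurj.comp {T D E : Type} [GCDGA T] [GCDGA D] [GCDGA E] {ψ : D →ₐ[ℚ] E}
    {φ : T →ₐ[ℚ] D} (hψ : AcyclicSurj ψ) (hφ : AcyclicSurj φ) : AcyclicSurj (ψ.comp φ) where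
  dga := isDGAHom_comp hψ.dga hφ.dga
  surj := hψ.surj.comp hφ.surj
  acyclic t ht hd := by
    obtain ⟨e, he, hde⟩ := hψ.acyclic (φ t) ht (by rw [← hφ.dga.1, hd, map_zero])
    obtain ⟨e, rfl⟩ := hφ.surj e
    obtain ⟨e', he', hde'⟩ := hφ.acyclic (t - Dd T e)
      (by rw [map_sub, hφ.dga.1, hde, sub_self]) (by rw [map_sub, hd, Dd_Dd, sub_self])
    refine ⟨e + e', ?_, by rw [map_add, hde']; abel⟩
    change ψ (φ (e + e')) = 0
    rw [map_add, he', add_zero]; exact he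

theorem AcyclicSurj.exists_closed_lift {T D : Type} [GCDGA T] [GCDGA D] {φ : T →ₐ[ℚ] D}
    (hφ : AcyclicSurj φ) {a : D} (ha : Dd D a = 0) : ∃ t, Dd T t = 0 ∧ φ t = a := by
  obtain ⟨t, rfl⟩ := hφ.surj a
  obtain ⟨e, he, hde⟩ := hφ.acyclic (Dd T t) (by rw [hφ.dga.1, ha]) (Dd_Dd t)
  exact ⟨t - e, by rw [map_sub, hde, sub_self], by rw [map_sub, he, sub_zero]⟩

theorem nonempty_htpyRetraction {T Q D : Type} [GCDGA T] [GCDGA Q] [GCDGA D] {φ : T →ₐ[ℚ] D}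
    (hφ : AcyclicSurj φ) {ρ : T →ₐ[ℚ] Q} (hρ : IsDGAHom ρ) {ψ : Q →ₐ[ℚ] D} (hψ : IsDGAHom ψ)
    (h : ψ.comp ρ = φ) : Nonempty (HtpyRetraction ρ) := by
  refine ⟨{ C := Pull φ ψ hφ.dga hψ, j := Pull.section₁ ρ h, q := Pull.snd _ _ _ _,
            τ := Pull.fst _ _ _ _, j_dga := Pull.section₁_dga ρ hρ h, q_dga := Pull.snd_dga,
            τ_dga := Pull.fst_dga, q_surj := ?_, q_quasi := ⟨?_, ?_⟩, hqj := rfl, hτj := rfl }⟩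
  · intro q
    obtain ⟨t, ht⟩ := hφ.surj (ψ q)
    exact ⟨Pull.mk _ _ _ _ t q ht, rfl⟩
  · intro q hq
    obtain ⟨t, hd, ht⟩ := hφ.exists_closed_lift (a := ψ q) (by rw [← hψ.1, hq, map_zero])
    refine ⟨Pull.mk _ _ _ _ t q ht, ?_, 0, by simp⟩
    ext
    · exact hd
    · exact hq
  · rintro x hx ⟨q, hq⟩
    obtain ⟨t, ht⟩ := hφ.surj (ψ q)
    obtain ⟨e, he, hde⟩ := hφ.acyclic (Pull.fst _ _ _ _ x - Dd T t)
      (by rw [map_sub, hφ.dga.1, ht, Pull.condition, hq, hψ.1, sub_self])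
      (by rw [map_sub, ← Pull.fst_dga.1, hx, Dd_Dd]; simp)
    refine ⟨Pull.mk _ _ _ _ (t + e) q (by rw [map_add, he, add_zero, ht]), ?_⟩
    ext
    · rw [Pull.fst_dga.1, Pull.fst_mk, map_add, hde]; abel
    · rw [Pull.snd_dga.1, Pull.snd_mk, hq]

end Pullback

section AcyclicExt

variable {T D : Type} [GCDGA T] [GCDGA D]

theorem Adm.map {n : ℕ} {f : T} (hf : Adm T n f) {φ : T →ₐ[ℚ] D} (hφ : IsDGAHom φ) :
    Adm D n (φ f) where
  mem := hφ.2 _ _ hf.mem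
  closed := by rw [← hφ.1, hf.closed, map_zero]
  even h := by rw [hf.even h, map_zero]

theorem adm_zero (n : ℕ) : Adm T n 0 := ⟨zero_mem _, map_zero _, fun _ => rfl⟩

namespace SqExt

variable {n : ℕ} {f : T} (hf : Adm T n f) {φ : T →ₐ[ℚ] D} (hφ : IsDGAHom φ)

/-- The extension of a morphism by the identity on the generator. -/
def map : SqExt T n f hf →ₐ[ℚ] SqExt D n (φ f) (hf.map hφ) :=
  lift ((incl D n (φ f) (hf.map hφ)).comp φ) (isDGAHom_comp incl_dga hφ) (gen D n _ _) gen_mem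
    gen_sq

@[simp] theorem fst_map (x : SqExt T n f hf) : (map hf hφ x).1 = φ x.1 := by
  simp [map, lift_apply]

@[simp] theorem snd_map (x : SqExt T n f hf) : (map hf hφ x).2 = φ x.2 := by
  simp [map, lift_apply]

theorem map_incl (a : T) : map hf hφ (incl T n f hf a) = incl D n _ _ (φ a) := by
  ext <;> simp

theorem map_gen : map hf hφ (gen T n f hf) = gen D n _ _ := by ext <;> simp

theorem map_dga : IsDGAHom (map hf hφ) := lift_dga _ _ _ _ _ Dd_gen

theorem map_acyclicSurj (h : AcyclicSurj φ) : AcyclicSurj (map hf h.dga) where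
  dga := map_dga hf h.dga
  surj x := by
    obtain ⟨a, ha⟩ := h.surj x.1
    obtain ⟨b, hb⟩ := h.surj x.2
    exact ⟨mk n f hf a b, by ext <;> simp [ha, hb]⟩
  acyclic x hx hd := by
    have hx1 : φ x.1 = 0 := by rw [← fst_map hf h.dga, hx, fst_zero]
    have hx2 : φ x.2 = 0 := by rw [← snd_map hf h.dga, hx, snd_zero]
    have hd1 : Dd T x.1 + tw T 1 x.2 * f = 0 := by rw [← fst_Dd, hd, fst_zero]
    have hd2 : Dd T x.2 = 0 := by rw [← snd_Dd, hd, snd_zero]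
    obtain ⟨c, hc, hdc⟩ := h.acyclic _ hx2 hd2
    obtain ⟨a, ha, hda⟩ := h.acyclic (x.1 - tw T 1 c * f)
      (by rw [map_sub, map_mul, map_tw φ h.dga.2, hx1, hc]; simp)
      (by
        have := tw_Dd 1 c
        rw [pow_one, neg_one_smul, hdc] at this
        rw [map_sub, Dd_mul, hf.closed, ← neg_eq_iff_eq_neg.mpr this, mul_zero, add_zero,
          neg_mul, sub_neg_eq_add, hd1])
    exact ⟨mk n f hf a c, by ext <;> simp [ha, hc], by ext <;> simp [hda, hdc]⟩

end SqExt

namespace PolyExt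

variable {n : ℕ} {hn : Even n}

theorem coef_mul_gen_sq (p : PolyExt T n hn) (k : ℕ) :
    coef (k + 2) (p * (gen T n hn * gen T n hn)) = coef k p := by
  induction p using PolyExt.induction with
  | mon l b => rw [gen, mon_mul_mon, mon_mul_mon, coef_mon, coef_mon]; simp
  | add p q hp hq => rw [add_mul, map_add, map_add, hp, hq]

theorem coef_mul_gen_sq_lt (p : PolyExt T n hn) {k : ℕ} (hk : k < 2) :
    coef k (p * (gen T n hn * gen T n hn)) = 0 := by
  rw [gen, mon_mul_mon, one_mul, coef_mul]
  refine Finset.sum_eq_zero fun x hx => ?_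
  have := Finset.HasAntidiagonal.mem_antidiagonal.mp hx
  rw [coef_mon, if_neg (by omega), mul_zero]

theorem exists_coef_eq (p : PolyExt T n hn) :
    ∃ q : PolyExt T n hn, ∀ k, coef k q = coef (k + 1) p :=
  ⟨Polynomial.divX (R := T) p, fun _ => Polynomial.coeff_divX (R := T)⟩

theorem exists_eq_mul_gen_sq (p : PolyExt T n hn) (h0 : coef 0 p = 0) (h1 : coef 1 p = 0) :
    ∃ q, p = q * (gen T n hn * gen T n hn) := by
  obtain ⟨p', hp'⟩ := exists_coef_eq p
  obtain ⟨q, hq⟩ := exists_coef_eq p'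
  refine ⟨q, ?_⟩
  ext k
  rcases k with _ | _ | k
  · rw [h0, coef_mul_gen_sq_lt _ (by norm_num)]
  · rw [h1, coef_mul_gen_sq_lt _ (by norm_num)]
  · rw [coef_mul_gen_sq, hq, hp']

theorem adm_gen_sq {m : ℕ} (hm : m + 1 = n + n) :
    Adm (PolyExt T n hn) m (gen T n hn * gen T n hn) where
  mem := hm ▸ mul_mem_Gr gen_mem gen_mem
  closed := Dd_mul_closed Dd_gen Dd_gen
  even h := by
    exfalso
    obtain ⟨a, rfl⟩ := h
    omega

variable (T hn) {m : ℕ} (hm : m + 1 = n + n)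

/-- The extension of `T` by a closed even generator `x` and `y` with `d y = x ^ 2`. -/
abbrev Sq : Type := SqExt (PolyExt T n hn) m (gen T n hn * gen T n hn) (adm_gen_sq hm)

/-- The truncation `y ↦ 0`, `x ^ 2 ↦ 0`. -/
def trunc : Sq T hn hm →ₐ[ℚ] SqExt T n 0 (adm_zero n) :=
  SqExt.lift (lift hn (SqExt.incl T n 0 _) (SqExt.gen T n 0 _) SqExt.gen_mem)
    (lift_dga _ _ _ SqExt.incl_dga (by rw [SqExt.Dd_gen, map_zero])) 0 (zero_mem _) (mul_zero 0)

theorem trunc_apply (x : Sq T hn hm) :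
    trunc T hn hm x = lift hn (SqExt.incl T n 0 _) (SqExt.gen T n 0 _) SqExt.gen_mem x.1 := by
  rw [trunc, SqExt.lift_apply, mul_zero, add_zero]

theorem lift_trunc (p : PolyExt T n hn) :
    lift hn (SqExt.incl T n 0 (adm_zero n)) (SqExt.gen T n 0 _) SqExt.gen_mem p =
      SqExt.mk n 0 _ (coef 0 p) (coef 1 p) := by
  induction p using PolyExt.induction with
  | mon k b =>
    rw [lift_mon, coef_mon, coef_mon]
    rcases k with _ | _ | k
    · ext <;> simp
    · ext <;> simp
    · rw [pow_succ, pow_succ, mul_assoc _ (SqExt.gen T n 0 _), SqExt.gen_sq]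
      ext <;> simp
  | add p q hp hq => rw [map_add, hp, hq]; ext <;> simp

theorem trunc_acyclicSurj : AcyclicSurj (trunc T hn hm) where
  dga := SqExt.lift_dga _ _ _ _ _ (by
    rw [map_mul, lift_gen, SqExt.gen_sq, map_zero])
  surj x := by
    refine ⟨SqExt.incl _ _ _ _ (mon 0 x.1 + mon 1 x.2), ?_⟩
    rw [trunc_apply, lift_trunc]
    ext <;> simp [coef_mon]
  acyclic x hx hd := by
    rw [trunc_apply, lift_trunc] at hx
    obtain ⟨p, hp⟩ := exists_eq_mul_gen_sq x.1 (congrArg Prod.fst hx) (congrArg Prod.snd hx)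
    have hd1 : Dd _ x.1 + tw _ 1 x.2 * (gen T n hn * gen T n hn) = 0 := by
      rw [← SqExt.fst_Dd, hd, SqExt.fst_zero]
    have hc : Dd _ (gen T n hn * gen T n hn) = 0 := Dd_mul_closed Dd_gen Dd_gen
    have hq : Dd _ p + tw _ 1 x.2 = 0 := by
      ext k
      rw [← coef_mul_gen_sq, add_mul, map_zero]
      rw [hp, Dd_mul, hc, mul_zero, add_zero] at hd1
      rw [hd1, map_zero]
    refine ⟨SqExt.mk _ _ _ 0 (tw _ 1 p), ?_, ?_⟩
    · rw [trunc_apply]; simp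
    · ext
      · simp [tw_tw, hp]
      · have h2 := tw_Dd 1 p
        rw [pow_one, neg_one_smul, eq_neg_of_add_eq_zero_left hq, map_neg, tw_tw] at h2
        rw [SqExt.snd_Dd, SqExt.snd_mk, (neg_injective h2).symm]

end PolyExt

end AcyclicExt

section Pairs

/-- An acyclic surjection onto a gcdga carrying a finite multiplicative filtration and a linear
functional vanishing on boundaries. -/
structure Pair where
  T : Type
  D : Type
  [instT : GCDGA T]
  [instD : GCDGA D]
  φ : T →ₐ[ℚ] D
  hφ : AcyclicSurj φ
  F : ℕ → Submodule ℚ D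
  F_zero : F 0 = ⊤
  F_anti : Antitone F
  F_mul : ∀ i j a b, a ∈ F i → b ∈ F j → a * b ∈ F (i + j)
  F_tw : ∀ n k a, a ∈ F k → tw D n a ∈ F k
  N : ℕ
  F_N : F N = ⊥
  int : D →ₗ[ℚ] ℚ
  int_d : ∀ a, int (Dd D a) = 0

attribute [instance] Pair.instT Pair.instD

namespace Pair

/-- The trivial pair. -/
def base : Pair where
  T := ℚ
  D := ℚ
  φ := AlgHom.id ℚ ℚ
  hφ := ⟨isDGAHom_id ℚ, Function.surjective_id, fun t ht _ => ⟨0, rfl, by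
    rw [map_zero]; exact ht.symm⟩⟩
  F k := if k = 0 then ⊤ else ⊥
  F_zero := if_pos rfl
  F_anti i j h := by
    rcases eq_or_ne i 0 with rfl | hi
    · simp
    · simp [hi, show j ≠ 0 by omega]
  F_mul i j a b ha hb := by
    rcases eq_or_ne i 0 with rfl | hi
    · rcases eq_or_ne j 0 with rfl | hj
      · simp
      · simp only [if_neg hj, Submodule.mem_bot] at hb
        simp [hb]
    · simp only [if_neg hi, Submodule.mem_bot] at ha
      simp [ha]
  F_tw n k a ha := by
    rcases eq_or_ne k 0 with rfl | hk
    · simp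
    · simp only [if_neg hk, Submodule.mem_bot] at ha
      simp [ha]
  N := 1
  F_N := if_neg one_ne_zero
  int := LinearMap.id
  int_d a := by rw [Dd_rat]; rfl

variable (P : Pair)

/-- Adjunction of a generator of square zero, placed in filtration `w`. -/
def sq (n : ℕ) (f : P.T) (hf : Adm P.T n f) (w : ℕ) : Pair where
  T := SqExt P.T n f hf
  D := SqExt P.D n (P.φ f) (hf.map P.hφ.dga)
  φ := SqExt.map hf P.hφ.dga
  hφ := SqExt.map_acyclicSurj hf P.hφ
  F k := ((P.F k).prod (P.F (k - w))).comap (SqExt.toProd _ _ _ _)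
  F_zero := by
    rw [Nat.zero_sub, P.F_zero, Submodule.prod_top, Submodule.comap_top]
  F_anti i j h := Submodule.comap_mono
    (Submodule.prod_mono (P.F_anti h) (P.F_anti (Nat.sub_le_sub_right h w)))
  F_mul i j a b ha hb := by
    refine ⟨P.F_mul _ _ _ _ ha.1 hb.1, add_mem ?_ ?_⟩
    · exact P.F_anti (by omega) (P.F_mul _ _ _ _ ha.1 hb.2)
    · exact P.F_anti (by omega) (P.F_mul _ _ _ _ ha.2 (P.F_tw _ _ _ hb.1))
  F_tw m k a ha := by
    refine ⟨?_, ?_⟩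
    · change (tw _ m a).1 ∈ _
      rw [SqExt.tw_fst]; exact P.F_tw _ _ _ ha.1
    · change (tw _ m a).2 ∈ _
      rw [SqExt.tw_snd]; exact Submodule.smul_mem _ _ (P.F_tw _ _ _ ha.2)
  N := P.N + w
  F_N := by
    have h : P.F (P.N + w) = ⊥ := le_bot_iff.mp (P.F_N ▸ P.F_anti (Nat.le_add_right _ _))
    rw [Nat.add_sub_cancel, P.F_N, h, Submodule.prod_bot]
    exact LinearMap.ker_eq_bot.mpr fun _ _ h => h
  int := P.int ∘ₗ SqExt.coef _ _ _ _
  int_d a := by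
    change P.int (Dd _ a).2 = 0
    rw [SqExt.snd_Dd, P.int_d]

/-- Precomposition with an acyclic surjection. -/
def pre {T' : Type} [GCDGA T'] (α : T' →ₐ[ℚ] P.T) (hα : AcyclicSurj α) : Pair :=
  { P with
    T := T'
    instT := inferInstance
    φ := P.φ.comp α
    hφ := P.hφ.comp hα }

/-- Adjunction to a pair of one even closed generator `x` and of `y` with `d y = x ^ 2`. -/
structure XYExt (P : Pair) (n m : ℕ) where
  P' : Pair
  i : P.T →ₐ[ℚ] P'.T
  i_dga : IsDGAHom i
  iD : P.D →ₐ[ℚ] P'.D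
  φ_i : ∀ a, P'.φ (i a) = iD (P.φ a)
  x : P'.T
  y : P'.T
  x_mem : x ∈ Gr P'.T n
  y_mem : y ∈ Gr P'.T m
  Dd_x : Dd P'.T x = 0
  Dd_y : Dd P'.T y = x * x
  adjoin : ∀ S : Subalgebra ℚ P'.T, (∀ a, i a ∈ S) → x ∈ S → y ∈ S → S = ⊤
  extend : ∀ (B : Type) [GCDGA B] (g : P.T →ₐ[ℚ] B), IsDGAHom g → ∀ u v : B, u ∈ Gr B n →
    v ∈ Gr B m → Dd B u = 0 → Dd B v = u * u →
    ∃ g' : P'.T →ₐ[ℚ] B, IsDGAHom g' ∧ g'.comp i = g ∧ g' x = u ∧ g' y = v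
  φ_y : P'.φ y = 0
  x_F : P'.φ x ∈ P'.F 1
  iD_F : ∀ k a, a ∈ P.F k → iD a ∈ P'.F k
  N_eq : P'.N = P.N + 1
  int_eq : ∀ a, P'.int (iD a * P'.φ x) = P.int a

section XY

variable {n m : ℕ} (hn : Even n) (hm : m + 1 = n + n)

/-- The map of the extension by `x` and `y`. -/
def xyMap : PolyExt.Sq P.T hn hm →ₐ[ℚ] SqExt P.D n (P.φ 0) ((adm_zero n).map P.hφ.dga) :=
  (SqExt.map (adm_zero n) P.hφ.dga).comp (PolyExt.trunc P.T hn hm)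

variable {P hn hm}

theorem xyMap_incl (a : P.T) :
    xyMap P hn hm (SqExt.incl _ _ _ _ (PolyExt.incl P.T n hn a)) =
      SqExt.incl _ _ _ _ (P.φ a) := by
  rw [xyMap, AlgHom.comp_apply, PolyExt.trunc_apply, SqExt.fst_incl, PolyExt.lift_incl,
    SqExt.map_incl]

theorem xyMap_x :
    xyMap P hn hm (SqExt.incl _ _ _ _ (PolyExt.gen P.T n hn)) = SqExt.gen _ _ _ _ := by
  rw [xyMap, AlgHom.comp_apply, PolyExt.trunc_apply, SqExt.fst_incl, PolyExt.lift_gen,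
    SqExt.map_gen]

theorem xyMap_y : xyMap P hn hm (SqExt.gen _ _ _ _) = 0 := by
  rw [xyMap, AlgHom.comp_apply, PolyExt.trunc_apply, SqExt.fst_gen]
  exact (congrArg _ (map_zero _)).trans (map_zero _)

theorem exists_xyLift {B : Type} [GCDGA B] {g : P.T →ₐ[ℚ] B} (hg : IsDGAHom g) {u v : B}
    (hu : u ∈ Gr B n) (hv : v ∈ Gr B m) (hdu : Dd B u = 0) (hdv : Dd B v = u * u) :
    ∃ g' : PolyExt.Sq P.T hn hm →ₐ[ℚ] B, IsDGAHom g' ∧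
      g'.comp ((SqExt.incl _ _ _ _).comp (PolyExt.incl P.T n hn)) = g ∧
      g' (SqExt.incl _ _ _ _ (PolyExt.gen P.T n hn)) = u ∧ g' (SqExt.gen _ _ _ _) = v := by
  have hm' : Odd m := by
    obtain ⟨k, rfl⟩ := hn
    exact ⟨2 * k - 1, by omega⟩
  have h := PolyExt.lift_dga (hn := hn) g u hu hg hdu
  refine ⟨SqExt.lift (PolyExt.lift hn g u hu) h v hv (odd_mul_self hm' hv), ?_, ?_, ?_, ?_⟩
  · exact SqExt.lift_dga _ _ _ _ _ (by rw [map_mul, PolyExt.lift_gen, hdv])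
  · ext a
    simp only [AlgHom.comp_apply, SqExt.lift_incl, PolyExt.lift_incl]
  · rw [SqExt.lift_incl, PolyExt.lift_gen]
  · rw [SqExt.lift_gen]

end XY

/-- Construction of the extension by `x` and `y`. -/
def xyExt {n m : ℕ} (hn : Even n) (hm : m + 1 = n + n) : XYExt P n m where
  P' := (P.sq n 0 (adm_zero n) 1).pre (PolyExt.trunc P.T hn hm)
    (PolyExt.trunc_acyclicSurj P.T hn hm)
  i := ((SqExt.incl _ _ _ _).comp (PolyExt.incl P.T n hn) : P.T →ₐ[ℚ] PolyExt.Sq P.T hn hm)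
  i_dga := (isDGAHom_comp SqExt.incl_dga PolyExt.incl_dga : IsDGAHom
    ((SqExt.incl _ _ _ _).comp (PolyExt.incl P.T n hn) : P.T →ₐ[ℚ] PolyExt.Sq P.T hn hm))
  iD := SqExt.incl P.D n (P.φ 0) ((adm_zero n).map P.hφ.dga)
  φ_i := xyMap_incl (hn := hn) (hm := hm)
  x := (SqExt.incl _ _ _ _ (PolyExt.gen P.T n hn) : PolyExt.Sq P.T hn hm)
  y := (SqExt.gen _ _ _ _ : PolyExt.Sq P.T hn hm)
  x_mem := (SqExt.incl_dga.2 _ _ PolyExt.gen_mem :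
    SqExt.incl _ _ _ _ (PolyExt.gen P.T n hn) ∈ Gr (PolyExt.Sq P.T hn hm) n)
  y_mem := (SqExt.gen_mem : SqExt.gen _ _ _ _ ∈ Gr (PolyExt.Sq P.T hn hm) m)
  Dd_x := by
    have h : Dd (PolyExt.Sq P.T hn hm) (SqExt.incl _ _ _ _ (PolyExt.gen P.T n hn)) = 0 := by
      rw [← SqExt.incl_dga.1, PolyExt.Dd_gen, map_zero]
    exact h
  Dd_y := by
    have h : Dd (PolyExt.Sq P.T hn hm) (SqExt.gen _ _ _ _) =
        SqExt.incl _ _ _ _ (PolyExt.gen P.T n hn) *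
          SqExt.incl _ _ _ _ (PolyExt.gen P.T n hn) := by
      rw [← map_mul]; exact SqExt.Dd_gen
    exact h
  adjoin S hi hx hy := by
    change Subalgebra ℚ (PolyExt.Sq P.T hn hm) at S
    have h : ⊤ ≤ S.comap (SqExt.incl _ _ _ (PolyExt.adm_gen_sq (T := P.T) (hn := hn) hm)) := by
      rw [← PolyExt.adjoin_gen]
      refine Algebra.adjoin_le ?_
      rintro _ (⟨a, rfl⟩ | rfl)
      · exact hi a
      · exact hx
    refine top_unique ?_
    have h' := SqExt.adjoin_gen (hf := PolyExt.adm_gen_sq (T := P.T) (hn := hn) hm)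
    refine h'.symm.le.trans (Algebra.adjoin_le ?_)
    rintro _ (⟨a, rfl⟩ | rfl)
    · exact h (Algebra.mem_top : a ∈ ⊤)
    · exact hy
  extend B _ g hg u v hu hv hdu hdv := exists_xyLift (hn := hn) (hm := hm) hg hu hv hdu hdv
  φ_y := xyMap_y (hn := hn) (hm := hm)
  x_F := by
    have h := xyMap_x (P := P) (hn := hn) (hm := hm)
    refine h.symm ▸ ⟨zero_mem _, ?_⟩
    change _ ∈ P.F 0
    rw [P.F_zero]; trivial
  iD_F k a ha := ⟨ha, zero_mem _⟩
  N_eq := rfl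
  int_eq a := by
    have h : P.int (SqExt.incl _ _ _ _ a * xyMap P hn hm
        (SqExt.incl _ _ _ _ (PolyExt.gen P.T n hn))).2 = P.int a := by
      rw [xyMap_x]
      simp
    exact h

/-- Adjunction to a pair of one odd generator `z` with `d z = f`. -/
structure ZExt (P : Pair) (n : ℕ) (f : P.T) (w : ℕ) where
  P' : Pair
  i : P.T →ₐ[ℚ] P'.T
  i_dga : IsDGAHom i
  iD : P.D →ₐ[ℚ] P'.D
  φ_i : ∀ a, P'.φ (i a) = iD (P.φ a)
  z : P'.T
  z_mem : z ∈ Gr P'.T n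
  Dd_z : Dd P'.T z = i f
  adjoin : ∀ S : Subalgebra ℚ P'.T, (∀ a, i a ∈ S) → z ∈ S → S = ⊤
  extend : ∀ (B : Type) [GCDGA B] (g : P.T →ₐ[ℚ] B), IsDGAHom g → ∀ u : B, u ∈ Gr B n →
    Dd B u = g f → ∃ g' : P'.T →ₐ[ℚ] B, IsDGAHom g' ∧ g'.comp i = g ∧ g' z = u
  z_F : P'.φ z ∈ P'.F w
  iD_F : ∀ k a, a ∈ P.F k → iD a ∈ P'.F k
  N_eq : P'.N = P.N + w
  int_eq : ∀ a, P'.int (iD a * P'.φ z) = P.int a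

/-- Construction of the extension by `z`. -/
def zExt {n : ℕ} (hn : Odd n) (f : P.T) (hf : f ∈ Gr P.T (n + 1)) (hd : Dd P.T f = 0) (w : ℕ) :
    ZExt P n f w :=
  have hA : Adm P.T n f := ⟨hf, hd, fun h => absurd h (Nat.not_even_iff_odd.mpr hn)⟩
  { P' := P.sq n f hA w
    i := SqExt.incl _ _ _ _
    i_dga := SqExt.incl_dga
    iD := SqExt.incl _ _ _ _
    φ_i := SqExt.map_incl hA P.hφ.dga
    z := SqExt.gen _ _ _ _
    z_mem := SqExt.gen_mem
    Dd_z := SqExt.Dd_gen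
    adjoin := fun S hi hz => by
      refine top_unique ?_
      have h' := SqExt.adjoin_gen (hf := hA)
      refine h'.symm.le.trans (Algebra.adjoin_le ?_)
      rintro _ (⟨a, rfl⟩ | rfl)
      · exact hi a
      · exact hz
    extend := fun B _ g hg u hu hdu =>
      ⟨SqExt.lift g hg u hu (odd_mul_self hn hu), SqExt.lift_dga _ _ _ _ _ hdu,
        AlgHom.ext fun a => SqExt.lift_incl g hg u hu (odd_mul_self hn hu) a,
        SqExt.lift_gen g hg u hu (odd_mul_self hn hu)⟩
    z_F := by
      refine (SqExt.map_gen hA P.hφ.dga).symm ▸ ⟨zero_mem _, ?_⟩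
      change _ ∈ P.F (w - w)
      rw [Nat.sub_self, P.F_zero]; trivial
    iD_F := fun k a ha => ⟨ha, zero_mem _⟩
    N_eq := rfl
    int_eq := fun a => by
      have h : P.int (SqExt.incl _ _ _ _ a *
          SqExt.map hA P.hφ.dga (SqExt.gen _ _ _ _)).2 = P.int a := by
        rw [SqExt.map_gen]
        simp
      exact h }

end Pair

end Pairs

section Quints

/-- A choice of five elements, candidates for the images of the generators. -/
@[ext] structure Quint (B : Type) where
  x₁ : B
  x₂ : B
  y₁ : B
  y₂ : B
  z : B

namespace Quint

variable {B C : Type}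

/-- The underlying set of elements. -/
def set (q : Quint B) : Set B := {q.x₁, q.x₂, q.y₁, q.y₂, q.z}

theorem forall_mem_set {q : Quint B} {p : B → Prop} :
    (∀ a ∈ q.set, p a) ↔ p q.x₁ ∧ p q.x₂ ∧ p q.y₁ ∧ p q.y₂ ∧ p q.z := by
  simp [Quint.set]

variable [GCDGA B] [GCDGA C]

/-- The degrees and the differentials are those of the generators of the model. -/
structure Good (q : Quint B) : Prop where
  x₁_mem : q.x₁ ∈ Gr B 4
  x₂_mem : q.x₂ ∈ Gr B 6
  y₁_mem : q.y₁ ∈ Gr B 7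
  y₂_mem : q.y₂ ∈ Gr B 11
  z_mem : q.z ∈ Gr B 9
  Dd_x₁ : Dd B q.x₁ = 0
  Dd_x₂ : Dd B q.x₂ = 0
  Dd_y₁ : Dd B q.y₁ = q.x₁ * q.x₁
  Dd_y₂ : Dd B q.y₂ = q.x₂ * q.x₂
  Dd_z : Dd B q.z = q.x₁ * q.x₂

/-- The image of a quintuple under a morphism. -/
def map (g : B →ₐ[ℚ] C) (q : Quint B) : Quint C := ⟨g q.x₁, g q.x₂, g q.y₁, g q.y₂, g q.z⟩

theorem Good.map {q : Quint B} (h : q.Good) {g : B →ₐ[ℚ] C} (hg : IsDGAHom g) :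
    (q.map g).Good where
  x₁_mem := hg.2 _ _ h.x₁_mem
  x₂_mem := hg.2 _ _ h.x₂_mem
  y₁_mem := hg.2 _ _ h.y₁_mem
  y₂_mem := hg.2 _ _ h.y₂_mem
  z_mem := hg.2 _ _ h.z_mem
  Dd_x₁ := by rw [Quint.map, ← hg.1, h.Dd_x₁, map_zero]
  Dd_x₂ := by rw [Quint.map, ← hg.1, h.Dd_x₂, map_zero]
  Dd_y₁ := by rw [Quint.map, ← hg.1, h.Dd_y₁, map_mul]
  Dd_y₂ := by rw [Quint.map, ← hg.1, h.Dd_y₂, map_mul]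
  Dd_z := by rw [Quint.map, ← hg.1, h.Dd_z, map_mul]

theorem map_eq_iff {f g : B →ₐ[ℚ] C} {q : Quint B} :
    q.map f = q.map g ↔ ∀ a ∈ q.set, f a = g a := by
  simp [Quint.map, Quint.set]

end Quint

/-- Adjunction to a pair of a copy of the five generators, the filtration of the last one being
prescribed after subtraction of `ζ`. -/
structure CopyExt (P : Pair) (ζ : P.T) (w : ℕ) where
  P' : Pair
  i : P.T →ₐ[ℚ] P'.T
  i_dga : IsDGAHom i
  iD : P.D →ₐ[ℚ] P'.D
  φ_i : ∀ a, P'.φ (i a) = iD (P.φ a)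
  q : Quint P'.T
  good : q.Good
  adjoin : ∀ S : Subalgebra ℚ P'.T, (∀ a, i a ∈ S) → q.set ⊆ S → S = ⊤
  extend : ∀ (B : Type) [GCDGA B] (g : P.T →ₐ[ℚ] B), IsDGAHom g → ∀ u : Quint B, u.Good →
    ∃ g' : P'.T →ₐ[ℚ] B, IsDGAHom g' ∧ g'.comp i = g ∧ q.map g' = u
  φ_y₁ : P'.φ q.y₁ = 0
  φ_y₂ : P'.φ q.y₂ = 0
  x₁_F : P'.φ q.x₁ ∈ P'.F 1
  x₂_F : P'.φ q.x₂ ∈ P'.F 1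
  z_F : P'.φ (q.z - i ζ) ∈ P'.F w
  iD_F : ∀ k a, a ∈ P.F k → iD a ∈ P'.F k
  N_eq : P'.N = P.N + 2 + w
  int_eq : ∀ a, P'.int (iD a * P'.φ q.x₁ * P'.φ q.x₂ * P'.φ (q.z - i ζ)) = P.int a

theorem CopyExt.mem_Gr {P : Pair} {ζ : P.T} (hζ : ζ ∈ Gr P.T 9) (E₁ : P.XYExt 4 7)
    (E₂ : E₁.P'.XYExt 6 11) :
    E₂.i E₁.x * E₂.x - E₂.i (E₁.i (Dd _ ζ)) ∈ Gr E₂.P'.T (9 + 1) :=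
  sub_mem (show _ ∈ Gr _ (4 + 6) from mul_mem_Gr (E₂.i_dga.2 4 _ E₁.x_mem) E₂.x_mem)
    (E₂.i_dga.2 _ _ (E₁.i_dga.2 _ _ (Dd_mem hζ)))

theorem CopyExt.closed {P : Pair} {ζ : P.T} (E₁ : P.XYExt 4 7) (E₂ : E₁.P'.XYExt 6 11) :
    Dd E₂.P'.T (E₂.i E₁.x * E₂.x - E₂.i (E₁.i (Dd _ ζ))) = 0 := by
  rw [map_sub, ← E₂.i_dga.1, ← E₁.i_dga.1, Dd_Dd, map_zero, map_zero, sub_zero]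
  exact Dd_mul_closed (by rw [← E₂.i_dga.1, E₁.Dd_x, map_zero]) E₂.Dd_x

/-- The extension by a copy of the generators, from extensions by `x₁, y₁`, `x₂, y₂` and `z`. -/
def CopyExt.ofExts {P : Pair} {ζ : P.T} (hζ : ζ ∈ Gr P.T 9) {w : ℕ} (E₁ : P.XYExt 4 7)
    (E₂ : E₁.P'.XYExt 6 11)
    (E₃ : E₂.P'.ZExt 9 (E₂.i E₁.x * E₂.x - E₂.i (E₁.i (Dd _ ζ))) w) : CopyExt P ζ w where
  P' := E₃.P'
  i := E₃.i.comp (E₂.i.comp E₁.i)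
  i_dga := isDGAHom_comp E₃.i_dga (isDGAHom_comp E₂.i_dga E₁.i_dga)
  iD := E₃.iD.comp (E₂.iD.comp E₁.iD)
  φ_i := fun a => by simp only [AlgHom.comp_apply, E₃.φ_i, E₂.φ_i, E₁.φ_i]
  q := ⟨E₃.i (E₂.i E₁.x), E₃.i E₂.x, E₃.i (E₂.i E₁.y), E₃.i E₂.y,
    E₃.z + E₃.i (E₂.i (E₁.i ζ))⟩
  good :=
    { x₁_mem := E₃.i_dga.2 _ _ (E₂.i_dga.2 _ _ E₁.x_mem)
      x₂_mem := E₃.i_dga.2 _ _ E₂.x_mem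
      y₁_mem := E₃.i_dga.2 _ _ (E₂.i_dga.2 _ _ E₁.y_mem)
      y₂_mem := E₃.i_dga.2 _ _ E₂.y_mem
      z_mem := add_mem E₃.z_mem (E₃.i_dga.2 _ _ (E₂.i_dga.2 _ _ (E₁.i_dga.2 _ _ hζ)))
      Dd_x₁ := by rw [← E₃.i_dga.1, ← E₂.i_dga.1, E₁.Dd_x, map_zero, map_zero]
      Dd_x₂ := by rw [← E₃.i_dga.1, E₂.Dd_x, map_zero]
      Dd_y₁ := by rw [← E₃.i_dga.1, ← E₂.i_dga.1, E₁.Dd_y, map_mul, map_mul]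
      Dd_y₂ := by rw [← E₃.i_dga.1, E₂.Dd_y, map_mul]
      Dd_z := by
        rw [map_add, E₃.Dd_z, ← E₃.i_dga.1, ← E₂.i_dga.1, ← E₁.i_dga.1, ← map_add,
          sub_add_cancel, map_mul] }
  adjoin := fun S hi hq => by
    rw [Set.subset_def, Quint.forall_mem_set] at hq
    obtain ⟨h₁, h₂, h₃, h₄, h₅⟩ := hq
    have H₁ : (S.comap E₃.i).comap E₂.i = ⊤ := E₁.adjoin _ hi h₁ h₃
    have H₂ : S.comap E₃.i = ⊤ :=
      E₂.adjoin _ (fun a => (H₁ ▸ Algebra.mem_top : a ∈ (S.comap E₃.i).comap E₂.i)) h₂ h₄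
    refine E₃.adjoin _ (fun a => (H₂ ▸ Algebra.mem_top : a ∈ S.comap E₃.i)) ?_
    exact (add_mem_cancel_right (hi ζ)).mp h₅
  extend := fun B _ g hg u hu => by
    obtain ⟨g₁, hg₁, c₁, a₁, b₁⟩ := E₁.extend B g hg _ _ hu.x₁_mem hu.y₁_mem hu.Dd_x₁ hu.Dd_y₁
    obtain ⟨g₂, hg₂, c₂, a₂, b₂⟩ :=
      E₂.extend B g₁ hg₁ _ _ hu.x₂_mem hu.y₂_mem hu.Dd_x₂ hu.Dd_y₂
    have e₁ : ∀ a, g₁ (E₁.i a) = g a := fun a => DFunLike.congr_fun c₁ a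
    have e₂ : ∀ a, g₂ (E₂.i a) = g₁ a := fun a => DFunLike.congr_fun c₂ a
    obtain ⟨g₃, hg₃, c₃, a₃⟩ := E₃.extend B g₂ hg₂ (u.z - g ζ)
      (sub_mem hu.z_mem (hg.2 _ _ hζ))
      (by rw [map_sub, hu.Dd_z, ← hg.1, map_sub, map_mul, e₂, e₂, e₁, a₁, a₂])
    have e₃ : ∀ a, g₃ (E₃.i a) = g₂ a := fun a => DFunLike.congr_fun c₃ a
    refine ⟨g₃, hg₃, ?_, ?_⟩
    · ext a
      simp only [AlgHom.comp_apply, e₃, e₂, e₁]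
    · ext <;> simp [Quint.map, e₃, e₂, e₁, a₁, a₂, a₃, b₁, b₂]
  φ_y₁ := by rw [E₃.φ_i, E₂.φ_i, E₁.φ_y, map_zero, map_zero]
  φ_y₂ := by rw [E₃.φ_i, E₂.φ_y, map_zero]
  x₁_F := by
    rw [E₃.φ_i, E₂.φ_i]
    exact E₃.iD_F _ _ (E₂.iD_F _ _ E₁.x_F)
  x₂_F := by
    rw [E₃.φ_i]
    exact E₃.iD_F _ _ E₂.x_F
  z_F := by
    rw [AlgHom.comp_apply, AlgHom.comp_apply, add_sub_cancel_right]
    exact E₃.z_F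
  iD_F := fun k a ha => E₃.iD_F _ _ (E₂.iD_F _ _ (E₁.iD_F _ _ ha))
  N_eq := by rw [E₃.N_eq, E₂.N_eq, E₁.N_eq]
  int_eq := fun a => by
    simp only [AlgHom.comp_apply, add_sub_cancel_right]
    rw [E₃.φ_i, E₃.φ_i, E₂.φ_i, ← map_mul, ← map_mul, E₃.int_eq, ← map_mul, E₂.int_eq,
      E₁.int_eq]

/-- Construction of the extension by a copy of the generators. -/
def copyExt (P : Pair) {ζ : P.T} (hζ : ζ ∈ Gr P.T 9) (w : ℕ) : CopyExt P ζ w :=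
  let E₁ := P.xyExt (n := 4) (m := 7) (by decide) rfl
  let E₂ := E₁.P'.xyExt (n := 6) (m := 11) (by decide) rfl
  CopyExt.ofExts hζ E₁ E₂ (E₂.P'.zExt (by decide) _ (CopyExt.mem_Gr hζ E₁ E₂)
    (CopyExt.closed E₁ E₂) w)

end Quints

section Cocycle

variable {R : Type} [Ring R]

/-- The cocycle `(y - b)² Y₁ - 2 (x - a) (y - b) Z + (x - a)² Y₂`. -/
def cocycle (x a y b Y₁ Y₂ Z : R) : R :=
  (y - b) * (y - b) * Y₁ - 2 * ((x - a) * (y - b) * Z) + (x - a) * (x - a) * Y₂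

theorem map_cocycle {R' F : Type} [Ring R'] [FunLike F R R'] [RingHomClass F R R'] (g : F)
    (x a y b Y₁ Y₂ Z : R) :
    g (cocycle x a y b Y₁ Y₂ Z) = cocycle (g x) (g a) (g y) (g b) (g Y₁) (g Y₂) (g Z) := by
  simp [cocycle, map_ofNat]

theorem exists_center {x : R} (h : ∀ t, x * t = t * x) : ∃ x' : Subring.center R, (x' : R) = x :=
  ⟨⟨x, Subring.mem_center_iff.mpr fun g => (h g).symm⟩, rfl⟩

theorem center_mul (p q : Subring.center R) (s t : R) :
    ((p : R) * s) * ((q : R) * t) = ((p * q : Subring.center R) : R) * (s * t) := by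
  have h := Subring.mem_center_iff.mp q.2 s
  rw [Subring.coe_mul, mul_assoc, ← mul_assoc s, h, mul_assoc, mul_assoc]

theorem cocycle_closed (x a y b : Subring.center R) :
    cocycle (x : R) a y b (x * x - a * a) (y * y - b * b) (x * y - a * b) = 0 := by
  have h : cocycle x a y b (x * x - a * a) (y * y - b * b) (x * y - a * b) = 0 := by
    rw [cocycle]; ring
  simpa [map_cocycle] using congrArg (Subring.center R).subtype h

variable {x a y b : Subring.center R} {Z ζ : R}

theorem cocycle_eq (x a y b : Subring.center R) (Z : R) :
    cocycle (x : R) a y b 0 0 Z = ((-2 * ((x - a) * (y - b)) : Subring.center R) : R) * Z := by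
  have h2 : ((2 : Subring.center R) : R) = 2 := rfl
  simp [cocycle, mul_assoc, h2]

theorem prod_eq (x a y b : Subring.center R) (Z ζ : R) :
    (a * b * ζ) * (x : R) * y * Z =
      ((a * b * (x * y) : Subring.center R) : R) * (ζ * Z) := by
  rw [← center_mul, Subring.coe_mul, Subring.coe_mul, mul_assoc _ (x : R), mul_assoc _ _ Z]

theorem cocycle_mul_prod (ha : a * a = 0) (hb : b * b = 0) (h : Z * ζ = -(ζ * Z)) :
    cocycle (x : R) a y b 0 0 Z * (a * b * ζ) = 2 * ((a * b * ζ) * x * y * Z) := by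
  have h₂ : -(-2 * ((x - a) * (y - b)) * (a * b)) = 2 * (a * b * (x * y)) := by
    linear_combination (-2 * (y - b) * b) * ha + (-2 * x * a) * hb
  replace h₂ := congrArg (Subring.center R).subtype h₂
  rw [map_mul _ 2, map_ofNat] at h₂
  rw [prod_eq, cocycle_eq, ← Subring.coe_mul, center_mul, h, ← neg_mul_comm, ← mul_assoc 2]
  exact congrArg (· * (ζ * Z)) h₂

theorem cocycle_mul_top (hx : x * x = 0) (ha : a * a = 0) (hy : y * y = 0) (hb : b * b = 0)
    (hZ : Z * Z = 0) (h : Z * ζ = -(ζ * Z)) :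
    cocycle (x : R) a y b 0 0 Z * (x - a) * (y * (Z + ζ) - b * ζ) =
      8 * ((a * b * ζ) * x * y * Z) := by
  have h₂ : -(-2 * ((x - a) * (y - b)) * (x - a) * (y - b)) = 8 * (a * b * (x * y)) := by
    linear_combination (2 * (y - b) ^ 2) * hx + (2 * (y - b) ^ 2) * ha
      - 4 * x * a * hy - 4 * x * a * hb
  replace h₂ := congrArg (Subring.center R).subtype h₂
  rw [map_mul _ 8, map_ofNat] at h₂
  have h₃ : cocycle (x : R) a y b 0 0 Z * (x - a) =
      ((-2 * ((x - a) * (y - b)) * (x - a) : Subring.center R) : R) * Z := by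
    have := center_mul (-2 * ((x - a) * (y - b))) (x - a) Z 1
    rwa [mul_one, mul_one, ← cocycle_eq] at this
  have h₄ : (y * (Z + ζ) - b * ζ : R) = y * Z + ((y - b : Subring.center R) : R) * ζ := by
    rw [AddSubgroupClass.coe_sub, mul_add, sub_mul]; abel
  rw [prod_eq, h₃, h₄, mul_add, center_mul, center_mul, hZ, mul_zero, zero_add, h,
    ← neg_mul_comm, ← mul_assoc 8]
  exact congrArg (· * (ζ * Z)) h₂

end Cocycle

namespace Quint

variable {B C : Type} [GCDGA B] [GCDGA C] {p q : Quint B}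

/-- The cocycle attached to two copies of the generators. -/
def coc (p q : Quint B) : B :=
  cocycle p.x₁ q.x₁ p.x₂ q.x₂ (p.y₁ - q.y₁) (p.y₂ - q.y₂) (p.z - q.z)

/-- The cocycle `x₂ z - x₁ y₂`. -/
def beta (q : Quint B) : B := q.x₂ * q.z - q.x₁ * q.y₂

/-- The longer cocycle attached to two copies of the generators. -/
def coctop (p q : Quint B) : B := coc p q * (p.x₁ - q.x₁) * (beta p - beta q)

theorem map_coc (g : B →ₐ[ℚ] C) : g (coc p q) = coc (p.map g) (q.map g) := by
  simp [coc, map_cocycle, Quint.map]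

theorem map_coctop (g : B →ₐ[ℚ] C) : g (coctop p q) = coctop (p.map g) (q.map g) := by
  simp only [coctop, map_mul, map_coc, map_sub, beta]
  rfl

namespace Good

theorem x₁_comm (h : q.Good) (t : B) : q.x₁ * t = t * q.x₁ :=
  even_mul_comm (by decide) h.x₁_mem t

theorem x₂_comm (h : q.Good) (t : B) : q.x₂ * t = t * q.x₂ :=
  even_mul_comm (by decide) h.x₂_mem t

theorem Dd_coc (hp : p.Good) (hq : q.Good) : Dd B (coc p q) = 0 := by
  have h₁ : p.x₁ - q.x₁ ∈ Gr B 4 := sub_mem hp.x₁_mem hq.x₁_mem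
  have h₂ : p.x₂ - q.x₂ ∈ Gr B 6 := sub_mem hp.x₂_mem hq.x₂_mem
  have d₁ : Dd B (p.x₁ - q.x₁) = 0 := by rw [map_sub, hp.Dd_x₁, hq.Dd_x₁, sub_zero]
  have d₂ : Dd B (p.x₂ - q.x₂) = 0 := by rw [map_sub, hp.Dd_x₂, hq.Dd_x₂, sub_zero]
  have e₁ := Dd_even_mul (by decide) h₁ d₁
  have e₂ := Dd_even_mul (by decide) h₂ d₂
  have h : Dd B (coc p q) = cocycle p.x₁ q.x₁ p.x₂ q.x₂ (p.x₁ * p.x₁ - q.x₁ * q.x₁)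
      (p.x₂ * p.x₂ - q.x₂ * q.x₂) (p.x₁ * p.x₂ - q.x₁ * q.x₂) := by
    rw [coc, cocycle, two_mul]
    simp only [mul_assoc, map_add, map_sub (Dd B) (_ * _), e₁, e₂]
    simp only [map_sub, hp.Dd_y₁, hq.Dd_y₁, hp.Dd_y₂, hq.Dd_y₂, hp.Dd_z, hq.Dd_z]
    rw [cocycle, two_mul]
    simp only [mul_assoc]
  obtain ⟨x, hx⟩ := exists_center hp.x₁_comm
  obtain ⟨a, ha⟩ := exists_center hq.x₁_comm
  obtain ⟨y, hy⟩ := exists_center hp.x₂_comm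
  obtain ⟨b, hb⟩ := exists_center hq.x₂_comm
  rw [h, ← hx, ← ha, ← hy, ← hb, cocycle_closed]

theorem Dd_beta (hq : q.Good) : Dd B q.beta = 0 := by
  rw [beta, map_sub, Dd_even_mul (by decide) hq.x₁_mem hq.Dd_x₁,
    Dd_even_mul (by decide) hq.x₂_mem hq.Dd_x₂, hq.Dd_z, hq.Dd_y₂, ← hq.x₂_comm q.x₁,
    hq.x₁_comm, hq.x₂_comm, mul_assoc, mul_assoc, hq.x₁_comm, sub_self]

theorem Dd_coctop (hp : p.Good) (hq : q.Good) : Dd B (coctop p q) = 0 := by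
  refine Dd_mul_closed (Dd_mul_closed (hp.Dd_coc hq) ?_) ?_
  · rw [map_sub, hp.Dd_x₁, hq.Dd_x₁, sub_zero]
  · rw [map_sub, hp.Dd_beta, hq.Dd_beta, sub_zero]

theorem x₁_sq (h : q.Good) (hy : q.y₁ = 0) : q.x₁ * q.x₁ = 0 := by
  rw [← h.Dd_y₁, hy, map_zero]

theorem x₂_sq (h : q.Good) (hy : q.y₂ = 0) : q.x₂ * q.x₂ = 0 := by
  rw [← h.Dd_y₂, hy, map_zero]

theorem z_anticomm (hp : p.Good) (hq : q.Good) : (p.z - q.z) * q.z = -(q.z * (p.z - q.z)) := by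
  have h := Gr_comm (sub_mem hp.z_mem hq.z_mem) hq.z_mem
  rwa [show (-1 : ℚ) ^ (9 * 9) = -1 by norm_num, neg_one_smul] at h

theorem coc_mul (hp : p.Good) (hq : q.Good) (hp₁ : p.y₁ = 0) (hp₂ : p.y₂ = 0)
    (hq₁ : q.y₁ = 0) (hq₂ : q.y₂ = 0) :
    coc p q * (q.x₁ * q.x₂ * q.z) =
      (2 : ℚ) • (q.x₁ * q.x₂ * q.z * p.x₁ * p.x₂ * (p.z - q.z)) := by
  have s₁ := hq.x₁_sq hq₁
  have s₂ := hq.x₂_sq hq₂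
  have h := hp.z_anticomm hq
  rw [coc, hp₁, hp₂, hq₁, hq₂, sub_zero]
  obtain ⟨x, hx⟩ := exists_center hp.x₁_comm
  obtain ⟨a, ha⟩ := exists_center hq.x₁_comm
  obtain ⟨y, hy⟩ := exists_center hp.x₂_comm
  obtain ⟨b, hb⟩ := exists_center hq.x₂_comm
  rw [← ha] at s₁
  rw [← hb] at s₂
  rw [← hx, ← ha, ← hy, ← hb, cocycle_mul_prod (Subtype.ext s₁) (Subtype.ext s₂) h,
    Algebra.smul_def, map_ofNat]

theorem coctop_eq (hp : p.Good) (hq : q.Good) (hp₁ : p.y₁ = 0) (hp₂ : p.y₂ = 0)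
    (hq₁ : q.y₁ = 0) (hq₂ : q.y₂ = 0) :
    coctop p q = (8 : ℚ) • (q.x₁ * q.x₂ * q.z * p.x₁ * p.x₂ * (p.z - q.z)) := by
  have s₁ := hq.x₁_sq hq₁
  have s₂ := hq.x₂_sq hq₂
  have t₁ := hp.x₁_sq hp₁
  have t₂ := hp.x₂_sq hp₂
  have h := hp.z_anticomm hq
  have hZ := odd_mul_self (by decide) (sub_mem hp.z_mem hq.z_mem)
  have hz : p.x₂ * p.z = p.x₂ * ((p.z - q.z) + q.z) := by rw [sub_add_cancel]
  rw [coctop, beta, beta, coc, hp₁, hp₂, hq₁, hq₂, sub_zero, mul_zero, mul_zero, sub_zero,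
    sub_zero, hz]
  obtain ⟨x, hx⟩ := exists_center hp.x₁_comm
  obtain ⟨a, ha⟩ := exists_center hq.x₁_comm
  obtain ⟨y, hy⟩ := exists_center hp.x₂_comm
  obtain ⟨b, hb⟩ := exists_center hq.x₂_comm
  rw [← ha] at s₁
  rw [← hb] at s₂
  rw [← hx] at t₁
  rw [← hy] at t₂
  rw [← hx, ← ha, ← hy, ← hb, cocycle_mul_top (Subtype.ext t₁) (Subtype.ext s₁)
    (Subtype.ext t₂) (Subtype.ext s₂) hZ h, Algebra.smul_def, map_ofNat]

end Good

theorem coc_mem (m : B →ₐ[ℚ] C) (h : p.map m = q.map m) : coc p q ∈ kerLin m ^ 3 := by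
  obtain ⟨h₁, h₂, h₃, h₄, h₅⟩ := Quint.ext_iff.mp h
  have k : ∀ {s t : B}, m s = m t → s - t ∈ kerLin m := fun h => by
    rw [mem_kerLin, map_sub, h, sub_self]
  have k₃ : ∀ {s t u : B}, s ∈ kerLin m → t ∈ kerLin m → u ∈ kerLin m →
      s * t * u ∈ kerLin m ^ 3 := fun hs ht hu => by
    rw [pow_succ, pow_two]
    exact Submodule.mul_mem_mul (Submodule.mul_mem_mul hs ht) hu
  refine add_mem (sub_mem (k₃ (k h₂) (k h₂) (k h₃)) ?_) (k₃ (k h₁) (k h₁) (k h₄))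
  rw [two_mul]
  exact add_mem (k₃ (k h₁) (k h₂) (k h₅)) (k₃ (k h₁) (k h₂) (k h₅))

theorem coctop_mem (m : B →ₐ[ℚ] C) (h : p.map m = q.map m) : coctop p q ∈ kerLin m ^ 5 := by
  rw [pow_succ, pow_succ]
  obtain ⟨h₁, h₂, h₃, h₄, h₅⟩ := Quint.ext_iff.mp h
  simp only [Quint.map] at h₁ h₂ h₃ h₄ h₅
  refine Submodule.mul_mem_mul (Submodule.mul_mem_mul (coc_mem m h) ?_) ?_
  · rw [mem_kerLin, map_sub, h₁, sub_self]
  · simp only [mem_kerLin, beta, map_sub, map_mul, h₁, h₂, h₄, h₅, sub_self]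

end Quint

section Stages

theorem kerLin_pow_map {T T' B : Type} [GCDGA T] [GCDGA T'] [GCDGA B] (m : T' →ₐ[ℚ] B)
    (i : T →ₐ[ℚ] T') (n : ℕ) {a : T} (h : a ∈ kerLin (m.comp i) ^ n) : i a ∈ kerLin m ^ n := by
  have h' : i a ∈ (kerLin (m.comp i) ^ n).map i.toLinearMap := ⟨a, h, rfl⟩
  rw [Submodule.map_pow] at h'
  have hle : (kerLin (m.comp i)).map i.toLinearMap ≤ kerLin m := by
    rintro _ ⟨b, hb, rfl⟩
    exact hb
  exact pow_le_pow_left' hle n h'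

/-- A model of the `(r + 1)`-fold tensor power with an acyclic surjection onto a finite dimensional
gcdga, and the classes detecting the top power of the augmentation ideal. -/
structure Stage (r : ℕ) where
  P : Pair
  q : Fin (r + 1) → Quint P.T
  good : ∀ j, (q j).Good
  adjoin : ∀ S : Subalgebra ℚ P.T, (∀ j, (q j).set ⊆ S) → S = ⊤
  univ : ∀ (B : Type) [GCDGA B] (f : Fin (r + 1) → Quint B), (∀ j, (f j).Good) →
    ∃ g : P.T →ₐ[ℚ] B, IsDGAHom g ∧ ∀ j, (q j).map g = f j
  φ_y₁ : ∀ j, P.φ (q j).y₁ = 0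
  φ_y₂ : ∀ j, P.φ (q j).y₂ = 0
  x₁_F : ∀ j, P.φ (q j).x₁ ∈ P.F 1
  x₂_F : ∀ j, P.φ (q j).x₂ ∈ P.F 1
  z_F : ∀ j, P.φ ((q j).z - (q 0).z) ∈ P.F 1
  N_eq : P.N = 3 * (r + 1)
  w : P.T
  Dd_w : Dd P.T w = 0
  w_mem : ∀ (B : Type) [GCDGA B] (m : P.T →ₐ[ℚ] B), (∀ j, (q j).map m = (q 0).map m) →
    w ∈ kerLin m ^ (3 * r)
  w_int : P.int (P.φ (w * ((q 0).x₁ * (q 0).x₂ * (q 0).z))) ≠ 0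
  top : 0 < r → ∃ W : P.T, Dd P.T W = 0 ∧
    (∀ (B : Type) [GCDGA B] (m : P.T →ₐ[ℚ] B), (∀ j, (q j).map m = (q 0).map m) →
      W ∈ kerLin m ^ (3 * r + 2)) ∧ P.int (P.φ W) ≠ 0

namespace Stage

/-- The stage with one copy, from an extension of the trivial pair. -/
def ofBase (E : CopyExt Pair.base (0 : ℚ) 0) : Stage 0 where
  P := E.P'
  q _ := E.q
  good _ := E.good
  adjoin S h := E.adjoin S (fun a => by
    have : E.i a = algebraMap ℚ _ a := AlgHom.commutes E.i a
    rw [this]; exact S.algebraMap_mem a) (h 0)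
  univ B _ f hf := by
    obtain ⟨g, hg, -, h⟩ := E.extend B (Algebra.ofId ℚ B) (isDGAHom_ofId B) _ (hf 0)
    exact ⟨g, hg, fun j => by rw [h, Fin.fin_one_eq_zero j]⟩
  φ_y₁ _ := E.φ_y₁
  φ_y₂ _ := E.φ_y₂
  x₁_F _ := E.x₁_F
  x₂_F _ := E.x₂_F
  z_F _ := by rw [sub_self, map_zero]; exact zero_mem _
  N_eq := E.N_eq
  w := 1
  Dd_w := Dd_one
  w_mem B _ m _ := by rw [mul_zero, pow_zero]; exact Submodule.one_le.mp le_rfl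
  w_int := by
    have h := E.int_eq (1 : ℚ)
    have h0 : E.i (0 : ℚ) = 0 := map_zero E.i
    have h1 : E.iD (1 : ℚ) = 1 := map_one E.iD
    rw [h0, h1, sub_zero, one_mul, ← map_mul, ← map_mul] at h
    rw [one_mul, h]
    exact one_ne_zero
  top h := absurd h (lt_irrefl 0)

section Step

variable {r : ℕ} (St : Stage r) (E : CopyExt St.P (St.q 0).z 1)

/-- The quintuples of the next stage. -/
def nextQ : Fin (r + 1 + 1) → Quint E.P'.T :=
  Fin.snoc (α := fun _ => Quint E.P'.T) (fun j => (St.q j).map E.i) E.q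

theorem nextQ_castSucc (j : Fin (r + 1)) : nextQ St E j.castSucc = (St.q j).map E.i :=
  Fin.snoc_castSucc ..

theorem nextQ_last : nextQ St E (Fin.last (r + 1)) = E.q := Fin.snoc_last ..

theorem nextQ_zero : nextQ St E 0 = (St.q 0).map E.i := nextQ_castSucc St E 0

theorem nextQ_forall {p : Quint E.P'.T → Prop} (h : ∀ j, p ((St.q j).map E.i)) (h' : p E.q)
    (j : Fin (r + 1 + 1)) : p (nextQ St E j) := by
  induction j using Fin.lastCases with
  | last => rwa [nextQ_last]
  | cast j => rw [nextQ_castSucc]; exact h j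

variable {St E} in
theorem map_comp_eq {B : Type} [GCDGA B] {m : E.P'.T →ₐ[ℚ] B}
    (h : ∀ j, (nextQ St E j).map m = (nextQ St E 0).map m) (j : Fin (r + 1)) :
    (St.q j).map (m.comp E.i) = (St.q 0).map (m.comp E.i) := by
  have := h j.castSucc
  rwa [nextQ_castSucc, nextQ_zero] at this

variable {St E} in
theorem map_last_eq {B : Type} [GCDGA B] {m : E.P'.T →ₐ[ℚ] B}
    (h : ∀ j, (nextQ St E j).map m = (nextQ St E 0).map m) :
    E.q.map m = ((St.q 0).map E.i).map m := by
  have := h (Fin.last _)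
  rwa [nextQ_last, nextQ_zero] at this

theorem good_map_i (j : Fin (r + 1)) : ((St.q j).map E.i).Good := (St.good j).map E.i_dga

theorem int_next : E.P'.int (E.iD (St.P.φ St.w) * ((((St.q 0).map E.i).map E.P'.φ).x₁ *
    (((St.q 0).map E.i).map E.P'.φ).x₂ * (((St.q 0).map E.i).map E.P'.φ).z *
      (E.q.map E.P'.φ).x₁ * (E.q.map E.P'.φ).x₂ *
        ((E.q.map E.P'.φ).z - (((St.q 0).map E.i).map E.P'.φ).z))) ≠ 0 := by
  have h := E.int_eq (St.P.φ (St.w * ((St.q 0).x₁ * (St.q 0).x₂ * (St.q 0).z)))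
  have h' := St.w_int
  rw [← h, map_sub] at h'
  simp only [Quint.map, E.φ_i, map_mul, mul_assoc] at h' ⊢
  exact h'

/-- The stage with one more copy. -/
def next : Stage (r + 1) :=
  have hq := E.good.map E.P'.hφ.dga
  have hq₀ := (good_map_i St E 0).map E.P'.hφ.dga
  have hy₁ : (((St.q 0).map E.i).map E.P'.φ).y₁ = 0 := by
    simp only [Quint.map]
    rw [E.φ_i, St.φ_y₁, map_zero]
  have hy₂ : (((St.q 0).map E.i).map E.P'.φ).y₂ = 0 := by
    simp only [Quint.map]
    rw [E.φ_i, St.φ_y₂, map_zero]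
  have hw : Dd _ (E.i St.w) = 0 := by rw [← E.i_dga.1, St.Dd_w, map_zero]
  { P := E.P'
    q := nextQ St E
    good := nextQ_forall St E (good_map_i St E) E.good
    adjoin := fun S h => by
      have h' : S.comap E.i = ⊤ := St.adjoin _ fun j => by
        have := h j.castSucc
        rw [nextQ_castSucc, Set.subset_def, Quint.forall_mem_set] at this
        rwa [Set.subset_def, Quint.forall_mem_set]
      refine E.adjoin S (fun a => (h' ▸ Algebra.mem_top : a ∈ S.comap E.i)) ?_
      have := h (Fin.last _)
      rwa [nextQ_last] at this
    univ := fun B _ f hf => by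
      obtain ⟨g, hg, h⟩ := St.univ B (fun j => f j.castSucc) fun j => hf _
      obtain ⟨g', hg', h₁, h₂⟩ := E.extend B g hg _ (hf (Fin.last _))
      refine ⟨g', hg', fun j => ?_⟩
      induction j using Fin.lastCases with
      | last => rw [nextQ_last, h₂]
      | cast j => rw [nextQ_castSucc, ← h j, ← h₁]; rfl
    φ_y₁ := nextQ_forall St E (p := fun q => E.P'.φ q.y₁ = 0)
      (fun j => by rw [Quint.map, E.φ_i, St.φ_y₁, map_zero]) E.φ_y₁
    φ_y₂ := nextQ_forall St E (p := fun q => E.P'.φ q.y₂ = 0)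
      (fun j => by rw [Quint.map, E.φ_i, St.φ_y₂, map_zero]) E.φ_y₂
    x₁_F := nextQ_forall St E (p := fun q => E.P'.φ q.x₁ ∈ E.P'.F 1)
      (fun j => by rw [Quint.map, E.φ_i]; exact E.iD_F _ _ (St.x₁_F j)) E.x₁_F
    x₂_F := nextQ_forall St E (p := fun q => E.P'.φ q.x₂ ∈ E.P'.F 1)
      (fun j => by rw [Quint.map, E.φ_i]; exact E.iD_F _ _ (St.x₂_F j)) E.x₂_F
    z_F := nextQ_forall St E (p := fun q => E.P'.φ (q.z - (nextQ St E 0).z) ∈ E.P'.F 1)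
      (fun j => by
        rw [nextQ_zero, Quint.map, Quint.map, ← map_sub, E.φ_i]
        exact E.iD_F _ _ (St.z_F j))
      (by rw [nextQ_zero]; exact E.z_F)
    N_eq := by rw [E.N_eq, St.N_eq]; ring
    w := E.i St.w * Quint.coc E.q ((St.q 0).map E.i)
    Dd_w := Dd_mul_closed hw (E.good.Dd_coc (good_map_i St E 0))
    w_mem := fun B _ m h => by
      rw [mul_add, mul_one, pow_add]
      exact Submodule.mul_mem_mul (kerLin_pow_map m E.i _ (St.w_mem B _ (map_comp_eq h)))
        (Quint.coc_mem m (map_last_eq h))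
    w_int := by
      rw [nextQ_zero, mul_assoc, map_mul E.P'.φ, E.φ_i, map_mul E.P'.φ, Quint.map_coc]
      have h := hq.coc_mul hq₀ E.φ_y₁ E.φ_y₂ hy₁ hy₂
      simp only [map_mul E.P'.φ]
      refine (congrArg (fun t => E.P'.int (E.iD (St.P.φ St.w) * t)) h).trans_ne ?_
      rw [mul_smul_comm, map_smul]
      exact smul_ne_zero two_ne_zero (int_next St E)
    top := fun _ => by
      refine ⟨E.i St.w * Quint.coctop E.q ((St.q 0).map E.i),
        Dd_mul_closed hw (E.good.Dd_coctop (good_map_i St E 0)), fun B _ m h => ?_, ?_⟩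
      · rw [mul_add, mul_one, add_assoc, pow_add]
        exact Submodule.mul_mem_mul (kerLin_pow_map m E.i _ (St.w_mem B _ (map_comp_eq h)))
          (Quint.coctop_mem m (map_last_eq h))
      · rw [map_mul E.P'.φ, E.φ_i, Quint.map_coctop,
          hq.coctop_eq hq₀ E.φ_y₁ E.φ_y₂ hy₁ hy₂, mul_smul_comm, map_smul]
        exact smul_ne_zero (by norm_num) (int_next St E) }

end Step

theorem nonempty (r : ℕ) : Nonempty (Stage r) := by
  induction r with
  | zero => exact ⟨ofBase (copyExt Pair.base (zero_mem _) 0)⟩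
  | succ r ih =>
    obtain ⟨St⟩ := ih
    exact ⟨next St (copyExt St.P (St.good 0).z_mem 1)⟩

end Stage

end Stages

section FreeModel

variable {A : Type} [GCDGA A]

namespace TensorPower

variable {r : ℕ} {T : Type} [GCDGA T] (TP : TensorPower A r T)

theorem mu_dga : IsDGAHom TP.mu :=
  (TP.coprod A (fun _ => AlgHom.id ℚ A) (fun _ => isDGAHom_id A)).choose_spec.1.1

theorem mu_ι (j : Fin r) : TP.mu.comp (TP.ι j) = AlgHom.id ℚ A :=
  (TP.coprod A (fun _ => AlgHom.id ℚ A) (fun _ => isDGAHom_id A)).choose_spec.1.2 j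

end TensorPower

/-- `A` is freely generated, as a gcdga, by a quintuple. -/
structure Quint.FreeOn (q : Quint A) : Prop where
  good : q.Good
  adjoin : Algebra.adjoin ℚ q.set = ⊤
  exists_lift : ∀ (B : Type) [GCDGA B] (u : Quint B), u.Good →
    ∃ g : A →ₐ[ℚ] B, IsDGAHom g ∧ q.map g = u

namespace Quint.FreeOn

variable {q : Quint A}

theorem hom_ext (h : q.FreeOn) {B : Type} [GCDGA B] {f g : A →ₐ[ℚ] B} (hfg : q.map f = q.map g) :
    f = g :=
  AlgHom.ext_of_adjoin_eq_top h.adjoin fun _ ha => map_eq_iff.mp hfg _ ha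

end Quint.FreeOn

namespace Stage

variable {r : ℕ} (St : Stage r) {q : Quint A}

theorem hom_ext {B : Type} [GCDGA B] {f g : St.P.T →ₐ[ℚ] B}
    (hfg : ∀ j, (St.q j).map f = (St.q j).map g) : f = g := by
  have h : AlgHom.equalizer f g = ⊤ :=
    St.adjoin _ fun j a ha => Quint.map_eq_iff.mp (hfg j) a ha
  ext a
  exact (h ▸ Algebra.mem_top : a ∈ AlgHom.equalizer f g)

/-- The structure of a tensor power on a stage. -/
def tensorPower (hq : q.FreeOn) : TensorPower A (r + 1) St.P.T where
  ι j := (hq.exists_lift _ _ (St.good j)).choose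
  ι_dga j := (hq.exists_lift _ _ (St.good j)).choose_spec.1
  coprod B _ f hf := by
    have hι := fun j => (hq.exists_lift _ _ (St.good j)).choose_spec.2
    obtain ⟨g, hg, h⟩ := St.univ B (fun j => q.map (f j)) fun j => hq.good.map (hf j)
    refine ⟨g, ⟨hg, fun j => hq.hom_ext ?_⟩, fun g' hg' => St.hom_ext fun j => ?_⟩
    · exact (congrArg (Quint.map g) (hι j)).trans (h j)
    · rw [h j, ← hg'.2 j]
      exact (congrArg (Quint.map g') (hι j)).symm

theorem map_ι (hq : q.FreeOn) (j : Fin (r + 1)) : q.map ((St.tensorPower hq).ι j) = St.q j :=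
  (hq.exists_lift _ _ (St.good j)).choose_spec.2

theorem map_mu (hq : q.FreeOn) (j : Fin (r + 1)) : (St.q j).map (St.tensorPower hq).mu = q := by
  have h : q.map ((St.tensorPower hq).mu.comp ((St.tensorPower hq).ι j)) = q := by
    rw [TensorPower.mu_ι]; rfl
  rw [← St.map_ι hq j]
  exact h

theorem φ_sub_mem (hq : q.FreeOn) (t : St.P.T) :
    St.P.φ t - St.P.φ ((St.tensorPower hq).ι 0 ((St.tensorPower hq).mu t)) ∈ St.P.F 1 := by
  set β := (St.P.φ.comp ((St.tensorPower hq).ι 0)).comp (St.tensorPower hq).mu with hβ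
  have hl : ∀ a b, b ∈ St.P.F 1 → a * b ∈ St.P.F 1 := fun a b hb =>
    St.P.F_mul 0 1 a b (St.P.F_zero ▸ Submodule.mem_top) hb
  have hr : ∀ a b, a ∈ St.P.F 1 → a * b ∈ St.P.F 1 := fun a b ha =>
    St.P.F_mul 1 0 a b ha (St.P.F_zero ▸ Submodule.mem_top)
  let s : Subalgebra ℚ St.P.T :=
    { carrier := {t | St.P.φ t - β t ∈ St.P.F 1}
      mul_mem' := fun {a b} ha hb => by
        have h : St.P.φ (a * b) - β (a * b) =
            (St.P.φ a - β a) * St.P.φ b + β a * (St.P.φ b - β b) := by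
          rw [map_mul, map_mul, sub_mul, mul_sub]; abel
        change _ ∈ St.P.F 1
        rw [h]
        exact add_mem (hr _ _ ha) (hl _ _ hb)
      add_mem' := fun {a b} ha hb => by
        change _ ∈ St.P.F 1
        rw [map_add, map_add, add_sub_add_comm]
        exact add_mem ha hb
      algebraMap_mem' := fun c => by
        change _ ∈ St.P.F 1
        rw [AlgHom.commutes, AlgHom.commutes, sub_self]
        exact zero_mem _ }
  have hs : s = ⊤ := St.adjoin s fun j => by
    have h : (St.q j).map β = (St.q 0).map St.P.φ :=
      (congrArg (fun u => Quint.map St.P.φ (Quint.map ((St.tensorPower hq).ι 0) u))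
        (St.map_mu hq j)).trans (congrArg (Quint.map St.P.φ) (St.map_ι hq 0))
    obtain ⟨h₁, h₂, h₃, h₄, h₅⟩ := Quint.ext_iff.mp h
    simp only [Quint.map] at h₁ h₂ h₃ h₄ h₅
    rw [Set.subset_def, Quint.forall_mem_set]
    refine ⟨?_, ?_, ?_, ?_, ?_⟩ <;> change _ ∈ St.P.F 1
    · rw [h₁]; exact sub_mem (St.x₁_F j) (St.x₁_F 0)
    · rw [h₂]; exact sub_mem (St.x₂_F j) (St.x₂_F 0)
    · rw [h₃, St.φ_y₁, St.φ_y₁, sub_self]; exact zero_mem _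
    · rw [h₄, St.φ_y₂, St.φ_y₂, sub_self]; exact zero_mem _
    · rw [h₅, ← map_sub]; exact St.z_F j
  exact (hs ▸ Algebra.mem_top : t ∈ s)

theorem φ_mem_of_kerPow (hq : q.FreeOn) (n : ℕ) {t : St.P.T}
    (ht : t ∈ kerLin (St.tensorPower hq).mu ^ n) :
    St.P.φ t ∈ St.P.F n := by
  suffices h : kerLin (St.tensorPower hq).mu ^ n ≤ (St.P.F n).comap St.P.φ.toLinearMap from h ht
  clear ht
  induction n with
  | zero =>
    rw [St.P.F_zero]
    exact fun _ _ => Submodule.mem_top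
  | succ n ih =>
    rw [pow_succ, Submodule.mul_le]
    intro a ha b hb
    have h := St.φ_sub_mem hq b
    rw [(mem_kerLin _).mp hb, map_zero, map_zero, sub_zero] at h
    change St.P.φ (a * b) ∈ St.P.F (n + 1)
    rw [map_mul]
    exact St.P.F_mul _ _ _ _ (ih ha) h

/-- The upper bound for the higher topological complexity. -/
theorem nonempty_tcWitness {r : ℕ} (St : Stage r) {q : Quint A} (hq : q.FreeOn) :
    Nonempty (TCWitness A (r + 1) (3 * r + 2)) := by
  have hm := (St.tensorPower hq).mu_dga
  have hker : ∀ a, DGQuot.mk _ (kerPow hm (3 * r + 2)) a = 0 → St.P.φ a = 0 := fun a ha => by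
    have h := St.φ_mem_of_kerPow hq _ (DGQuot.mk_eq_zero.mp ha)
    have hN : St.P.N = 3 * r + 2 + 1 := by rw [St.N_eq]; ring
    rwa [← hN, St.P.F_N] at h
  have hs : Function.Surjective (DGQuot.mk _ (kerPow hm (3 * r + 2))) := DGQuot.mk_surjective
  refine ⟨{
    T := St.P.T
    TP := St.tensorPower hq
    Q := DGQuot St.P.T (kerPow hm (3 * r + 2))
    ρ := DGQuot.mk _ _
    ρ_dga := DGQuot.mk_dga
    ρ_surj := hs
    ρ_ker := ker_mk_kerPow hm _
    retr := nonempty_htpyRetraction (ψ := factorAlg _ hs St.P.φ hker) St.P.hφ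
      DGQuot.mk_dga ?_ ?_ }⟩
  · constructor
    · intro b
      obtain ⟨a, rfl⟩ := hs b
      rw [← DGQuot.mk_dga.1, factorAlg_apply, factorAlg_apply, St.P.hφ.dga.1]
    · rintro i _ ⟨a, ha, rfl⟩
      exact (factorAlg_apply _ hs _ hker a).symm ▸ St.P.hφ.dga.2 i a ha
  · ext a
    exact factorAlg_apply _ hs _ hker a

theorem kerLin_pow_le {T B : Type} [GCDGA T] [GCDGA B] (m : T →ₐ[ℚ] B) {k n : ℕ} (h : k + 1 ≤ n) :
    kerLin m ^ n ≤ kerLin m ^ (k + 1) := by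
  obtain ⟨l, rfl⟩ := Nat.exists_eq_add_of_le' h
  rw [pow_add, Submodule.mul_le]
  exact fun a _ b hb => mul_mem_kerPow m k a hb

/-- The lower bound for the higher topological complexity. -/
theorem le_of_tcWitness {r : ℕ} (St : Stage r) {q : Quint A} (hq : q.FreeOn) (hr : 0 < r) {n : ℕ}
    (w : TCWitness A (r + 1) n) : 3 * r + 2 ≤ n := by
  by_contra! hn
  obtain ⟨W, hW, hWm, hWi⟩ := St.top hr
  let _ := w.instT
  let _ := w.instQ
  obtain ⟨g, hg, hgq⟩ := St.univ w.T (fun j => q.map (w.TP.ι j)) fun j =>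
    hq.good.map (w.TP.ι_dga j)
  obtain ⟨h, ⟨hh, hhι⟩, -⟩ := w.TP.coprod _ (St.tensorPower hq).ι (St.tensorPower hq).ι_dga
  have hhg : h.comp g = AlgHom.id ℚ St.P.T := St.hom_ext fun j => by
    have e : (St.q j).map (h.comp g) = q.map (h.comp (w.TP.ι j)) :=
      congrArg (Quint.map h) (hgq j)
    rw [e, hhι, map_ι]
    rfl
  have hgW : g W ∈ w.TP.kerMu ^ (n + 1) := by
    refine kerLin_pow_le w.TP.mu hn (kerLin_pow_map w.TP.mu g _ (hWm A _ fun j => ?_))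
    have e : ∀ j, (St.q j).map (w.TP.mu.comp g) = q := fun j => by
      have e₁ : (St.q j).map (w.TP.mu.comp g) = q.map (w.TP.mu.comp (w.TP.ι j)) :=
        congrArg (Quint.map w.TP.mu) (hgq j)
      rw [e₁, TensorPower.mu_ι]
      rfl
    rw [e, e]
  obtain ⟨R⟩ := w.retr
  rw [← w.ρ_ker] at hgW
  have hρ : R.q (R.j (g W)) = 0 := (DFunLike.congr_fun R.hqj (g W)).trans hgW
  obtain ⟨e, he⟩ := R.q_quasi.2 (R.j (g W))
    (by rw [← R.j_dga.1, ← hg.1, hW, map_zero, map_zero]) ⟨0, by rw [hρ, map_zero]⟩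
  have hτ : g W = R.τ (R.j (g W)) := (DFunLike.congr_fun R.hτj (g W)).symm
  have hW' : W = h (g W) := (DFunLike.congr_fun hhg W).symm
  apply hWi
  rw [hW', hτ, he, R.τ_dga.1, hh.1, St.P.hφ.dga.1, St.P.int_d]

end Stage

/-- The value of the higher topological complexity for a free gcdga on a quintuple. -/
theorem Quint.FreeOn.TC_eq {q : Quint A} (hq : q.FreeOn) {r : ℕ} (hr : 0 < r) :
    TC A (r + 1) = 3 * r + 2 := by
  obtain ⟨St⟩ := Stage.nonempty r
  have h := St.nonempty_tcWitness hq
  exact le_antisymm (Nat.sInf_le h) (le_csInf ⟨_, h⟩ fun n ⟨w⟩ => St.le_of_tcWitness hq hr w)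

end FreeModel

section Sullivan

/-- The universal property with respect to morphisms of graded algebras suffices. -/
theorem Quint.FreeOn.of_graded {A : Type} [GCDGA A] {q : Quint A} (hq : q.Good)
    (lift : ∀ (B : Type) [GCDGA B] (u : Quint B), u.Good →
      ∃ g : A →ₐ[ℚ] B, (∀ (i : ℕ) (a : A), a ∈ Gr A i → g a ∈ Gr B i) ∧ q.map g = u)
    (ext : ∀ (B : Type) [GCDGA B] (f g : A →ₐ[ℚ] B),
      (∀ (i : ℕ) (a : A), a ∈ Gr A i → f a ∈ Gr B i) →
      (∀ (i : ℕ) (a : A), a ∈ Gr A i → g a ∈ Gr B i) → q.map f = q.map g → f = g) :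
    q.FreeOn := by
  have adj : Algebra.adjoin ℚ q.set = ⊤ := by
    obtain ⟨St⟩ := Stage.nonempty 0
    obtain ⟨π, hπ, hπq⟩ := St.univ A (fun _ => q) fun _ => hq
    obtain ⟨σ, hσ, hσq⟩ := lift _ _ (St.good 0)
    have hπσ : π.comp σ = AlgHom.id ℚ A :=
      ext A _ _ (fun i a ha => hπ.2 i _ (hσ i a ha)) (fun _ _ ha => ha)
        ((congrArg (Quint.map π) hσq).trans (hπq 0))
    have htop : (Algebra.adjoin ℚ q.set).comap π = ⊤ := St.adjoin _ fun j => by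
      have h := Algebra.subset_adjoin (R := ℚ) (s := q.set)
      rw [Set.subset_def, Quint.forall_mem_set] at h ⊢
      rw [← hπq j] at h ⊢
      exact h
    refine top_unique fun a _ => ?_
    have ha : σ a ∈ (Algebra.adjoin ℚ q.set).comap π := htop ▸ Algebra.mem_top
    have e : π (σ a) = a := DFunLike.congr_fun hπσ a
    rwa [Subalgebra.mem_comap, e] at ha
  refine ⟨hq, adj, fun B _ u hu => ?_⟩
  obtain ⟨g, hg, rfl⟩ := lift B u hu
  refine ⟨g, isDGAHom_of_adjoin g hg adj (Quint.forall_mem_set.mpr ⟨?_, ?_, ?_, ?_, ?_⟩), rfl⟩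
  · rw [hq.Dd_x₁, map_zero]; exact hu.Dd_x₁.symm
  · rw [hq.Dd_x₂, map_zero]; exact hu.Dd_x₂.symm
  · rw [hq.Dd_y₁, map_mul]; exact hu.Dd_y₁.symm
  · rw [hq.Dd_y₂, map_mul]; exact hu.Dd_y₂.symm
  · rw [hq.Dd_z, map_mul]; exact hu.Dd_z.symm

theorem exists_graded_functional {A B : Type} [GCDGA A] [GCDGA B] {a : A} (ha : a ≠ 0) {k : ℕ}
    {b : B} (hb : b ∈ Gr B k) : ∃ f : ℕ → A →ₗ[ℚ] B,
      (∀ n v, f n v ∈ Gr B n) ∧ f k a = b ∧ ∀ n, n ≠ k → f n = 0 := by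
  obtain ⟨l, hl⟩ := Module.Projective.exists_dual_ne_zero ℚ ha
  refine ⟨Pi.single k (l.smulRight ((l a)⁻¹ • b)), fun n v => ?_, ?_, fun n hn =>
    Pi.single_eq_of_ne hn _⟩
  · rcases eq_or_ne n k with rfl | hn
    · rw [Pi.single_eq_same]
      exact Submodule.smul_mem _ _ (Submodule.smul_mem _ _ hb)
    · rw [Pi.single_eq_of_ne hn]
      exact zero_mem _
  · rw [Pi.single_eq_same, LinearMap.smulRight_apply, smul_smul, mul_inv_cancel₀ hl, one_smul]

variable {A : Type} [GCDGA A] (S : MinimalSullivan A)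

theorem MinimalSullivan.freeOn (q : Quint A) (hq : q.Good)
    (hx₁ : S.V 4 = Submodule.span ℚ {q.x₁}) (hx₂ : S.V 6 = Submodule.span ℚ {q.x₂})
    (hy₁ : S.V 7 = Submodule.span ℚ {q.y₁}) (hz : S.V 9 = Submodule.span ℚ {q.z})
    (hy₂ : S.V 11 = Submodule.span ℚ {q.y₂})
    (hother : ∀ n : ℕ, n ∉ ({4, 6, 7, 9, 11} : Set ℕ) → S.V n = ⊥)
    (hx₁ne : q.x₁ ≠ 0) (hx₂ne : q.x₂ ≠ 0) (hy₁ne : q.y₁ ≠ 0) (hy₂ne : q.y₂ ≠ 0)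
    (hzne : q.z ≠ 0) : q.FreeOn := by
  refine .of_graded hq (fun B _ u hu => ?_) fun B _ f g hf hg hfg => ?_
  · obtain ⟨f₁, hf₁, h₁, h₁'⟩ := exists_graded_functional hx₁ne hu.x₁_mem
    obtain ⟨f₂, hf₂, h₂, h₂'⟩ := exists_graded_functional hx₂ne hu.x₂_mem
    obtain ⟨f₃, hf₃, h₃, h₃'⟩ := exists_graded_functional hy₁ne hu.y₁_mem
    obtain ⟨f₄, hf₄, h₄, h₄'⟩ := exists_graded_functional hy₂ne hu.y₂_mem
    obtain ⟨f₅, hf₅, h₅, h₅'⟩ := exists_graded_functional hzne hu.z_mem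
    obtain ⟨g, ⟨hg, hgV⟩, -⟩ := S.free B
      (fun n => (f₁ n + f₂ n + f₃ n + f₄ n + f₅ n) ∘ₗ (S.V n).subtype) fun n v =>
        add_mem (add_mem (add_mem (add_mem (hf₁ n v) (hf₂ n v)) (hf₃ n v)) (hf₄ n v)) (hf₅ n v)
    have key : ∀ {n : ℕ} {a : A}, S.V n = Submodule.span ℚ {a} →
        g a = f₁ n a + f₂ n a + f₃ n a + f₄ n a + f₅ n a := fun {n a} h =>
      hgV n ⟨a, h ▸ Submodule.mem_span_singleton_self a⟩
    refine ⟨g, hg, Quint.ext ?_ ?_ ?_ ?_ ?_⟩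
    · refine (key hx₁).trans ?_
      simp [h₁, h₂', h₃', h₄', h₅']
    · refine (key hx₂).trans ?_
      simp [h₁', h₂, h₃', h₄', h₅']
    · refine (key hy₁).trans ?_
      simp [h₁', h₂', h₃, h₄', h₅']
    · refine (key hy₂).trans ?_
      simp [h₁', h₂', h₃', h₄, h₅']
    · refine (key hz).trans ?_
      simp [h₁', h₂', h₃', h₄', h₅]
  · have hle : ∀ n, S.V n ≤ LinearMap.eqLocus f.toLinearMap g.toLinearMap := fun n => by
      obtain ⟨e₁, e₂, e₃, e₄, e₅⟩ := Quint.ext_iff.mp hfg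
      have hs : ∀ a, f a = g a →
          Submodule.span ℚ {a} ≤ LinearMap.eqLocus f.toLinearMap g.toLinearMap := fun a ha =>
        (Submodule.span_singleton_le_iff_mem ..).mpr ha
      by_cases hn : n ∈ ({4, 6, 7, 9, 11} : Set ℕ)
      · rcases hn with rfl | rfl | rfl | rfl | rfl
        · exact hx₁ ▸ hs _ e₁
        · exact hx₂ ▸ hs _ e₂
        · exact hy₁ ▸ hs _ e₃
        · exact hz ▸ hs _ e₅
        · exact hy₂ ▸ hs _ e₄
      · rw [hother n hn]
        exact bot_le
    exact (S.free B (fun n => g.toLinearMap ∘ₗ (S.V n).subtype) fun n v =>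
      hg n v (S.V_le n v.2)).unique ⟨hf, fun n v => hle n v.2⟩ ⟨hg, fun _ _ => rfl⟩

end Sullivan

/-- For the minimal Sullivan model
`(ΛV,d) = (Λ(x₁,x₂,y₁,y₂,z),d)` of `SU(6)/(SU(3)×SU(3))`, with `|x₁| = 4`,
`|x₂| = 6`, `dx₁ = dx₂ = 0`, `dy₁ = x₁²`, `dy₂ = x₂²`, `dz = x₁x₂`, one has
`TC_r(ΛV) = 3r − 1` for every `r ≥ 2`. -/
theorem TC_SU6_quotient (A : Type) [GCDGA A] (S : MinimalSullivan A)
    (x₁ x₂ y₁ y₂ z : A)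
    (hx₁ : S.V 4 = Submodule.span ℚ {x₁}) (hx₂ : S.V 6 = Submodule.span ℚ {x₂})
    (hy₁ : S.V 7 = Submodule.span ℚ {y₁}) (hz : S.V 9 = Submodule.span ℚ {z})
    (hy₂ : S.V 11 = Submodule.span ℚ {y₂})
    (hother : ∀ n : ℕ, n ∉ ({4, 6, 7, 9, 11} : Set ℕ) → S.V n = ⊥)
    (hx₁ne : x₁ ≠ 0) (hx₂ne : x₂ ≠ 0) (hy₁ne : y₁ ≠ 0) (hy₂ne : y₂ ≠ 0)
    (hzne : z ≠ 0)
    (hdx₁ : Dd A x₁ = 0) (hdx₂ : Dd A x₂ = 0)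
    (hdy₁ : Dd A y₁ = x₁ ^ 2) (hdy₂ : Dd A y₂ = x₂ ^ 2)
    (hdz : Dd A z = x₁ * x₂)
    (r : ℕ) (hr : 2 ≤ r) :
    TC A r = 3 * r - 1 := by
  have mem : ∀ {n : ℕ} {a : A}, S.V n = Submodule.span ℚ {a} → a ∈ Gr A n := fun {n a} h =>
    S.V_le n (h ▸ Submodule.mem_span_singleton_self a)
  have hq : Quint.FreeOn ⟨x₁, x₂, y₁, y₂, z⟩ :=
    S.freeOn ⟨x₁, x₂, y₁, y₂, z⟩ ⟨mem hx₁, mem hx₂, mem hy₁, mem hy₂, mem hz, hdx₁, hdx₂,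
      hdy₁.trans (pow_two _), hdy₂.trans (pow_two _), hdz⟩ hx₁ hx₂ hy₁ hz hy₂ hother
      hx₁ne hx₂ne hy₁ne hy₂ne hzne
  obtain ⟨s, rfl⟩ := Nat.exists_eq_add_of_le' hr
  have h := hq.TC_eq (r := s + 1) s.succ_pos
  rw [h]
  omega

end RHT
end
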